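/- Let p, q, r be real polynomials with deg p ≤ m, deg q ≤ n, deg r ≤ l, and let μ(k) = 2k²/(1+k²). Suppose the function I(k) = p(k)K(k) + q(k)E(k) + r(k)Π(μ(k),k) is not identically zero on (−1,1). Then the number of zeros of I in (−1,1), counted with multiplicity, does not exceed ψ(m,n,l), where ψ(m,n,l) = 2·max{m,n} + 3l + 11 if l ≤ max{m,n} + 2, and ψ(m,n,l) = 5l + 7 if l > max{m,n} + 2. -/

import Mathlib

/-- Complete elliptic integral of the first kind. -/
noncomputable def Kc (k : ℝ) : ℝ :=
  ∫ z in (0:ℝ)..1, 1 / Real.sqrt ((1 - z ^ 2) * (1 - k ^ 2 * z ^ 2))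

/-- Complete elliptic integral of the second kind. -/
noncomputable def Ec (k : ℝ) : ℝ :=
  ∫ z in (0:ℝ)..1, Real.sqrt (1 - k ^ 2 * z ^ 2) / Real.sqrt (1 - z ^ 2)

/-- Complete elliptic integral of the third kind. -/
noncomputable def Pic (μ k : ℝ) : ℝ :=
  ∫ z in (0:ℝ)..1, 1 / ((1 - μ * z ^ 2) * Real.sqrt ((1 - z ^ 2) * (1 - k ^ 2 * z ^ 2)))

/-- Multiplicity (order of vanishing) of a zero of a real function. -/
noncomputable def zeroMult (φ : ℝ → ℝ) (x : ℝ) : ℕ :=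
  sInf {n : ℕ | iteratedDeriv n φ x ≠ 0}

open PowerSeries Filter Topology

/-- The power series `f` is absolutely summable at radius `ρ`. -/
def AbsSummableAt (ρ : ℝ) (f : ℝ⟦X⟧) : Prop :=
  Summable fun n => |coeff n f| * ρ ^ n

/-- The power series `f` converges absolutely on the open unit disc. -/
def ConvergesOnDisc (f : ℝ⟦X⟧) : Prop :=
  ∀ ρ : ℝ, 0 < ρ → ρ < 1 → AbsSummableAt ρ f

/-- The sum of the power series `f` at `x`. -/
noncomputable def seriesSum (f : ℝ⟦X⟧) (x : ℝ) : ℝ :=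
  ∑' n, coeff n f * x ^ n

namespace AbsSummableAt

variable {ρ : ℝ} {f g : ℝ⟦X⟧}

lemma add (hρ : 0 ≤ ρ) (hf : AbsSummableAt ρ f) (hg : AbsSummableAt ρ g) :
    AbsSummableAt ρ (f + g) := by
  refine Summable.of_nonneg_of_le (fun n => by positivity) (fun n => ?_) (Summable.add hf hg)
  rw [map_add, ← add_mul]
  gcongr
  exact abs_add_le _ _

lemma mul (hρ : 0 ≤ ρ) (hf : AbsSummableAt ρ f) (hg : AbsSummableAt ρ g) :
    AbsSummableAt ρ (f * g) := by
  have h := summable_sum_mul_antidiagonal_of_summable_mul (f := fun n => |coeff n f| * ρ ^ n)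
    (g := fun n => |coeff n g| * ρ ^ n)
    (Summable.mul_of_nonneg hf hg (fun n => by positivity) (fun n => by positivity))
  refine Summable.of_nonneg_of_le (fun n => by positivity) (fun n => ?_) h
  rw [coeff_mul]
  calc |∑ p ∈ Finset.HasAntidiagonal.antidiagonal n, coeff p.1 f * coeff p.2 g| * ρ ^ n
      ≤ (∑ p ∈ Finset.HasAntidiagonal.antidiagonal n, |coeff p.1 f * coeff p.2 g|) * ρ ^ n := by
        gcongr
        exact Finset.abs_sum_le_sum_abs _ _
    _ = _ := by
        rw [Finset.sum_mul]
        refine Finset.sum_congr rfl fun p hp => ?_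
        rw [← Finset.HasAntidiagonal.mem_antidiagonal.1 hp, pow_add, abs_mul]
        ring

lemma of_finite {N : ℕ} (h : ∀ n, N ≤ n → coeff n f = 0) : AbsSummableAt ρ f := by
  refine summable_of_ne_finset_zero (s := Finset.range N) fun n hn => ?_
  rw [h n (by simpa using hn)]
  simp

lemma coe (p : Polynomial ℝ) : AbsSummableAt ρ (p : ℝ⟦X⟧) :=
  of_finite (N := p.natDegree + 1) fun n hn => by
    rw [Polynomial.coeff_coe, Polynomial.coeff_eq_zero_of_natDegree_lt (by omega)]

lemma C (a : ℝ) : AbsSummableAt ρ (PowerSeries.C a) := by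
  simpa using coe (ρ := ρ) (Polynomial.C a)

lemma X : AbsSummableAt ρ PowerSeries.X := by
  simpa using coe (ρ := ρ) Polynomial.X

lemma one : AbsSummableAt ρ 1 := by
  simpa using coe (ρ := ρ) 1

lemma C_mul (hρ : 0 ≤ ρ) (a : ℝ) (hf : AbsSummableAt ρ f) :
    AbsSummableAt ρ (PowerSeries.C a * f) := (C a).mul hρ hf

lemma neg (hf : AbsSummableAt ρ f) : AbsSummableAt ρ (-f) := by
  simpa [AbsSummableAt] using hf

lemma sub (hρ : 0 ≤ ρ) (hf : AbsSummableAt ρ f) (hg : AbsSummableAt ρ g) :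
    AbsSummableAt ρ (f - g) := by
  rw [sub_eq_add_neg]
  exact hf.add hρ hg.neg

lemma pow (hρ : 0 ≤ ρ) (hf : AbsSummableAt ρ f) (n : ℕ) : AbsSummableAt ρ (f ^ n) := by
  induction n with
  | zero => simpa using one
  | succ n ih => rw [pow_succ]; exact ih.mul hρ hf

lemma of_X_mul (hρ : 0 < ρ) (hf : AbsSummableAt ρ (PowerSeries.X * f)) : AbsSummableAt ρ f := by
  have h : Summable fun n => |coeff (n + 1) (PowerSeries.X * f)| * ρ ^ (n + 1) :=
    (summable_nat_add_iff (f := fun n => |coeff n (PowerSeries.X * f)| * ρ ^ n) 1).2 hf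
  refine (h.mul_left ρ⁻¹).congr fun n => ?_
  rw [coeff_succ_X_mul, pow_succ]
  field_simp

lemma tail (hρ : 0 < ρ) (hf : AbsSummableAt ρ f) :
    AbsSummableAt ρ (mk fun n => coeff (n + 1) f) := by
  refine of_X_mul hρ ?_
  rw [show PowerSeries.X * mk (fun n => coeff (n + 1) f) = f - PowerSeries.C (coeff 0 f) by
    simpa using (sub_const_eq_X_mul_shift f).symm]
  exact hf.sub hρ.le (C _)

lemma exists_bound (hρ : 0 < ρ) (hf : AbsSummableAt ρ f) :
    ∃ B, 0 ≤ B ∧ ∀ n, |coeff n f| ≤ B * (ρ⁻¹) ^ n := by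
  refine ⟨∑' n, |coeff n f| * ρ ^ n, tsum_nonneg fun n => by positivity, fun n => ?_⟩
  have := Summable.le_tsum hf n fun m _ => by positivity
  rw [inv_pow, ← div_eq_mul_inv, le_div_iff₀ (by positivity)]
  exact this

end AbsSummableAt

namespace ConvergesOnDisc

variable {f g : ℝ⟦X⟧}

lemma of_bounded {B : ℝ} (h : ∀ n, |coeff n f| ≤ B) : ConvergesOnDisc f := fun ρ h0 h1 =>
  Summable.of_nonneg_of_le (fun n => by positivity)
    (fun n => by gcongr; exact h n) ((summable_geometric_of_lt_one h0.le h1).mul_left B)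

lemma add (hf : ConvergesOnDisc f) (hg : ConvergesOnDisc g) : ConvergesOnDisc (f + g) :=
  fun ρ h0 h1 => (hf ρ h0 h1).add h0.le (hg ρ h0 h1)

lemma sub (hf : ConvergesOnDisc f) (hg : ConvergesOnDisc g) : ConvergesOnDisc (f - g) :=
  fun ρ h0 h1 => (hf ρ h0 h1).sub h0.le (hg ρ h0 h1)

lemma mul (hf : ConvergesOnDisc f) (hg : ConvergesOnDisc g) : ConvergesOnDisc (f * g) :=
  fun ρ h0 h1 => (hf ρ h0 h1).mul h0.le (hg ρ h0 h1)

lemma coe (p : Polynomial ℝ) : ConvergesOnDisc (p : ℝ⟦X⟧) := fun _ _ _ => .coe p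

lemma C (a : ℝ) : ConvergesOnDisc (PowerSeries.C a) := fun _ _ _ => .C a

lemma X : ConvergesOnDisc PowerSeries.X := fun _ _ _ => .X

lemma one : ConvergesOnDisc 1 := fun _ _ _ => .one

lemma pow (hf : ConvergesOnDisc f) (n : ℕ) : ConvergesOnDisc (f ^ n) :=
  fun ρ h0 h1 => (hf ρ h0 h1).pow h0.le n

lemma summable_norm (hf : ConvergesOnDisc f) {x : ℝ} (hx : |x| < 1) :
    Summable fun n => ‖coeff n f * x ^ n‖ := by
  obtain ⟨ρ, h1, h2⟩ := exists_between hx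
  have h0 : 0 < ρ := (abs_nonneg x).trans_lt h1
  refine Summable.of_nonneg_of_le (fun n => by positivity) (fun n => ?_) (hf ρ h0 h2)
  rw [norm_mul, norm_pow, Real.norm_eq_abs, Real.norm_eq_abs]
  gcongr

lemma summable (hf : ConvergesOnDisc f) {x : ℝ} (hx : |x| < 1) :
    Summable fun n => coeff n f * x ^ n := (hf.summable_norm hx).of_norm

lemma seriesSum_add (hf : ConvergesOnDisc f) (hg : ConvergesOnDisc g) {x : ℝ} (hx : |x| < 1) :
    seriesSum (f + g) x = seriesSum f x + seriesSum g x := by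
  simp only [seriesSum, map_add, add_mul]
  exact (hf.summable hx).tsum_add (hg.summable hx)

lemma seriesSum_sub (hf : ConvergesOnDisc f) (hg : ConvergesOnDisc g) {x : ℝ} (hx : |x| < 1) :
    seriesSum (f - g) x = seriesSum f x - seriesSum g x := by
  simp only [seriesSum, map_sub, sub_mul]
  exact (hf.summable hx).tsum_sub (hg.summable hx)

lemma seriesSum_mul (hf : ConvergesOnDisc f) (hg : ConvergesOnDisc g) {x : ℝ} (hx : |x| < 1) :
    seriesSum (f * g) x = seriesSum f x * seriesSum g x := by
  unfold seriesSum
  rw [tsum_mul_tsum_eq_tsum_sum_antidiagonal_of_summable_norm (hf.summable_norm hx)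
    (hg.summable_norm hx)]
  refine tsum_congr fun n => ?_
  rw [coeff_mul, Finset.sum_mul]
  refine Finset.sum_congr rfl fun p hp => ?_
  rw [← Finset.HasAntidiagonal.mem_antidiagonal.1 hp, pow_add]
  ring

end ConvergesOnDisc

lemma seriesSum_coe (p : Polynomial ℝ) (x : ℝ) : seriesSum (p : ℝ⟦X⟧) x = p.eval x := by
  rw [seriesSum, Polynomial.eval_eq_sum_range, tsum_eq_sum (s := Finset.range (p.natDegree + 1))]
  · simp
  · intro n hn
    rw [Polynomial.coeff_coe, Polynomial.coeff_eq_zero_of_natDegree_lt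
      (by simpa [Nat.lt_succ_iff] using hn), zero_mul]

lemma seriesSum_C (a x : ℝ) : seriesSum (C a) x = a := by
  simpa using seriesSum_coe (Polynomial.C a) x

lemma seriesSum_X (x : ℝ) : seriesSum X x = x := by
  simpa using seriesSum_coe Polynomial.X x

lemma seriesSum_one (x : ℝ) : seriesSum 1 x = 1 := by
  simpa using seriesSum_coe 1 x

lemma seriesSum_expand (f : ℝ⟦X⟧) (x : ℝ) :
    seriesSum (expand 2 two_ne_zero f) x = seriesSum f (x ^ 2) := by
  unfold seriesSum
  have hinj : Function.Injective fun n : ℕ => 2 * n := fun a b h => by simpa using h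
  rw [← hinj.tsum_eq]
  · refine tsum_congr fun n => ?_
    rw [coeff_expand_mul, pow_mul]
  · intro n hn
    by_contra h
    refine hn ?_
    dsimp only
    rw [coeff_expand_of_not_dvd, zero_mul]
    rintro ⟨m, rfl⟩
    exact h ⟨m, rfl⟩

lemma ConvergesOnDisc.expand {f : ℝ⟦X⟧} (hf : ConvergesOnDisc f) :
    ConvergesOnDisc (PowerSeries.expand 2 two_ne_zero f) := by
  intro ρ h0 h1
  have hinj : Function.Injective fun n : ℕ => 2 * n := fun a b h => by simpa using h
  refine (hinj.summable_iff fun n hn => ?_).1 ?_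
  · rw [coeff_expand_of_not_dvd]
    · simp
    rintro ⟨m, rfl⟩
    exact hn ⟨m, rfl⟩
  · refine (hf (ρ ^ 2) (by positivity) (by nlinarith)).congr fun n => ?_
    simp [coeff_expand_mul, pow_mul]

lemma ConvergesOnDisc.analyticAt {f : ℝ⟦X⟧} (hf : ConvergesOnDisc f) {x : ℝ} (hx : |x| < 1) :
    AnalyticAt ℝ (seriesSum f) x := by
  set p := FormalMultilinearSeries.ofScalars ℝ fun n => coeff n f with hp
  have hr : 1 ≤ p.radius := by
    refine ENNReal.le_of_forall_nnreal_lt fun r hr => ?_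
    have hr1 : (r : ℝ) < 1 := by exact_mod_cast hr
    refine p.le_radius_of_summable ?_
    rcases eq_or_lt_of_le r.2 with h0 | h0
    · refine summable_of_ne_finset_zero (s := {0}) fun n hn => ?_
      have : r = 0 := NNReal.eq h0.symm
      simp [this, zero_pow (show n ≠ 0 by simpa using hn)]
    · refine (hf r h0 hr1).congr fun n => ?_
      rw [hp, FormalMultilinearSeries.ofScalars_norm, Real.norm_eq_abs]
  have h := (p.hasFPowerSeriesOnBall (zero_lt_one.trans_le hr)).analyticAt_of_mem (y := x) (by
    refine Metric.eball_subset_eball hr ?_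
    simpa [edist_dist, Real.dist_eq, ENNReal.ofReal_lt_one] using hx)
  refine h.congr (Eventually.of_forall fun y => ?_)
  simp [seriesSum, FormalMultilinearSeries.sum, hp, mul_comm]

lemma ConvergesOnDisc.derivative {f : ℝ⟦X⟧} (hf : ConvergesOnDisc f) :
    ConvergesOnDisc (d⁄dX ℝ f) := by
  intro ρ h0 h1
  obtain ⟨σ, h2, h3⟩ := exists_between h1
  have hσ : 0 < σ := h0.trans h2
  obtain ⟨B, hB, hb⟩ := (hf σ hσ h3).exists_bound hσ
  have hq : ‖ρ / σ‖ < 1 := by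
    rw [Real.norm_of_nonneg (by positivity), div_lt_one hσ]
    exact h2
  have hs := summable_pow_mul_geometric_of_norm_lt_one 1 hq
  have hs' := (hs.add (summable_geometric_of_norm_lt_one hq)).mul_left (B * σ⁻¹)
  refine Summable.of_nonneg_of_le (fun n => by positivity) (fun n => ?_) hs'
  rw [coeff_derivative, abs_mul, abs_of_nonneg (by positivity : (0 : ℝ) ≤ n + 1)]
  calc |coeff (n + 1) f| * (n + 1) * ρ ^ n ≤ (B * σ⁻¹ ^ (n + 1)) * (n + 1) * ρ ^ n := by
        gcongr
        exact hb _
    _ = _ := by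
        rw [div_pow, pow_succ, inv_pow]
        field_simp

lemma ConvergesOnDisc.hasDerivAt {f : ℝ⟦X⟧} (hf : ConvergesOnDisc f) {x : ℝ} (hx : |x| < 1) :
    HasDerivAt (seriesSum f) (seriesSum (d⁄dX ℝ f) x) x := by
  obtain ⟨ρ, h1, h2⟩ := exists_between hx
  have h0 : 0 < ρ := (abs_nonneg x).trans_lt h1
  have hu := hf.derivative ρ h0 h2
  have hu' : Summable fun n => |coeff n f| * n * ρ ^ (n - 1) := by
    refine (summable_nat_add_iff 1).1 (hu.congr fun n => ?_)
    rw [coeff_derivative, abs_mul, abs_of_nonneg (by positivity : (0 : ℝ) ≤ n + 1)]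
    simp
  have hx' : x ∈ Metric.ball (0 : ℝ) ρ := by simpa using h1
  have h := hasDerivAt_tsum_of_isPreconnected (𝕜 := ℝ) (g := fun n y => coeff n f * y ^ n)
    (g' := fun n y => coeff n f * (n * y ^ (n - 1))) hu' Metric.isOpen_ball
    (convex_ball (0 : ℝ) ρ).isPreconnected
    (fun n y _ => (hasDerivAt_pow n y).const_mul _) (fun n y hy => ?_) hx' (hf.summable hx) hx'
  · refine h.congr_deriv ?_
    have hs : Summable fun n => coeff n f * (n * x ^ (n - 1)) := by
      refine Summable.of_norm_bounded hu' fun n => ?_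
      rw [norm_mul, norm_mul, norm_pow, Real.norm_eq_abs, Real.norm_eq_abs, Real.norm_eq_abs,
        abs_of_nonneg (by positivity : (0 : ℝ) ≤ n), mul_assoc]
      gcongr
    rw [hs.tsum_eq_zero_add, seriesSum]
    simp [coeff_derivative, mul_assoc]
  · have hy' : |y| ≤ ρ := by simpa using (Metric.mem_ball.1 hy).le
    rw [norm_mul, norm_mul, norm_pow, Real.norm_eq_abs, Real.norm_eq_abs, Real.norm_eq_abs,
      abs_of_nonneg (by positivity : (0 : ℝ) ≤ n), mul_assoc]
    gcongr

lemma ConvergesOnDisc.exists_eq_X_sub_C_mul {f : ℝ⟦X⟧} (hf : ConvergesOnDisc f) {x : ℝ}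
    (hx : |x| < 1) (h0 : seriesSum f x = 0) :
    ∃ h, ConvergesOnDisc h ∧ f = (PowerSeries.X - PowerSeries.C x) * h := by
  have hs : ∀ n, Summable fun i => coeff (i + n) f * x ^ i := by
    intro n
    rcases eq_or_ne x 0 with rfl | hx0
    · refine summable_of_ne_finset_zero (s := {0}) fun i hi => ?_
      simp [zero_pow (show i ≠ 0 by simpa using hi)]
    · refine (((summable_nat_add_iff n).2 (hf.summable hx)).mul_left (x ^ n)⁻¹).congr fun i => ?_
      rw [pow_add]
      field_simp
  set t : ℕ → ℝ := fun n => ∑' i, coeff (i + n) f * x ^ i with ht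
  have hrec : ∀ n, t n = coeff n f + x * t (n + 1) := by
    intro n
    simp only [ht]
    rw [(hs n).tsum_eq_zero_add, ← tsum_mul_left]
    congr 1
    · simp
    · refine tsum_congr fun i => ?_
      rw [show i + 1 + n = i + (n + 1) by ring, pow_succ]
      ring
  refine ⟨mk fun n => t (n + 1), ?_, ?_⟩
  · intro ρ hρ0 hρ1
    obtain ⟨σ, h1, h2⟩ := exists_between (max_lt hx hρ1)
    have hxσ : |x| < σ := (le_max_left _ _).trans_lt h1
    have hρσ : ρ < σ := (le_max_right _ _).trans_lt h1
    have hσ : 0 < σ := hρ0.trans hρσ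
    obtain ⟨B, hB, hb⟩ := (hf σ hσ h2).exists_bound hσ
    have hq : |x| / σ < 1 := (div_lt_one hσ).2 hxσ
    have hg := summable_geometric_of_lt_one (by positivity) hq
    have hbound : ∀ n, |t n| ≤ B * σ⁻¹ ^ n * ∑' i, (|x| / σ) ^ i := by
      intro n
      rw [← tsum_mul_left]
      refine tsum_of_norm_bounded (f := fun i => coeff (i + n) f * x ^ i)
        (hg.mul_left _).hasSum fun i => ?_
      rw [norm_mul, norm_pow, Real.norm_eq_abs, Real.norm_eq_abs]
      calc |coeff (i + n) f| * |x| ^ i ≤ B * σ⁻¹ ^ (i + n) * |x| ^ i := by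
            gcongr
            exact hb _
        _ = _ := by
            rw [div_pow, pow_add, inv_pow]
            field_simp
    have hq' : ρ / σ < 1 := (div_lt_one hσ).2 hρσ
    refine Summable.of_nonneg_of_le (fun n => by positivity) (fun n => ?_)
      ((summable_geometric_of_lt_one (by positivity) hq').mul_left
        (B * σ⁻¹ * ∑' i, (|x| / σ) ^ i))
    rw [coeff_mk]
    calc |t (n + 1)| * ρ ^ n ≤ (B * σ⁻¹ ^ (n + 1) * ∑' i, (|x| / σ) ^ i) * ρ ^ n := by
          gcongr
          exact hbound _
      _ = _ := by
          rw [div_pow, pow_succ, inv_pow]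
          field_simp
  · ext n
    rw [sub_mul, map_sub, coeff_C_mul, coeff_mk]
    cases n with
    | zero =>
      have h1 : t 0 = 0 := by simpa [ht, seriesSum] using h0
      rw [coeff_zero_X_mul]
      linarith [hrec 0]
    | succ n =>
      rw [coeff_succ_X_mul, coeff_mk]
      linarith [hrec (n + 1)]

lemma seriesSum_X_sub_C_mul {h : ℝ⟦X⟧} (hh : ConvergesOnDisc h) (x : ℝ) {y : ℝ} (hy : |y| < 1) :
    seriesSum ((X - C x) * h) y = (y - x) * seriesSum h y := by
  rw [(ConvergesOnDisc.X.sub (.C x)).seriesSum_mul hh hy, ConvergesOnDisc.X.seriesSum_sub (.C x) hy,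
    seriesSum_X, seriesSum_C]

/-- A convergent power series whose sum vanishes to order at least `m x` at each `x ∈ T` is
divisible by the product of the corresponding linear factors, with a convergent quotient. -/
lemma ConvergesOnDisc.exists_eq_prod_mul (T : Finset ℝ) (hT : ∀ x ∈ T, |x| < 1) (N : ℕ) :
    ∀ {f : ℝ⟦X⟧} {m : ℝ → ℕ}, ConvergesOnDisc f →
      (∀ x ∈ T, (m x : ℕ∞) ≤ analyticOrderAt (seriesSum f) x) → ∑ x ∈ T, m x = N →
      ∃ (l : List ℝ) (h : ℝ⟦X⟧), l.length = N ∧ (∀ x ∈ l, |x| < 1) ∧ ConvergesOnDisc h ∧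
        f = (l.map fun x => (PowerSeries.X - PowerSeries.C x)).prod * h := by
  induction N with
  | zero => intro f m hf _ _; exact ⟨[], f, by simp [hf]⟩
  | succ N ih =>
    intro f m hf hm hN
    obtain ⟨a, haT, ha⟩ : ∃ a ∈ T, m a ≠ 0 := by
      by_contra! h
      rw [Finset.sum_eq_zero h] at hN
      omega
    have ha1 := hT a haT
    have hfa : seriesSum f a = 0 := by
      by_contra h
      have := hm a haT
      rw [((hf.analyticAt ha1).analyticOrderAt_eq_zero).2 h] at this
      exact ha (by simpa using this)
    obtain ⟨h, hh, rfl⟩ := hf.exists_eq_X_sub_C_mul ha1 hfa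
    have hord : ∀ x, |x| < 1 →
        analyticOrderAt (seriesSum ((PowerSeries.X - PowerSeries.C a) * h)) x =
        analyticOrderAt (fun y : ℝ => y - a) x + analyticOrderAt (seriesSum h) x := by
      intro x hx
      rw [← analyticOrderAt_mul (by fun_prop) (hh.analyticAt hx)]
      refine analyticOrderAt_congr ?_
      filter_upwards [(continuous_abs.isOpen_preimage _ isOpen_Iio).mem_nhds hx] with y hy
      exact seriesSum_X_sub_C_mul hh a hy
    obtain ⟨l, h', hl, hl1, hh', rfl⟩ := ih (m := fun x => if x = a then m a - 1 else m x) hh (by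
        intro x hx
        have h1 := hm x hx
        rw [hord x (hT x hx)] at h1
        split_ifs with hxa
        · subst hxa
          have h2 : analyticOrderAt (fun y : ℝ => y - x) x = 1 := by simp
          rw [h2, show m x = 1 + (m x - 1) by omega, Nat.cast_add, Nat.cast_one] at h1
          exact (ENat.add_le_add_iff_left (by simp)).1 h1
        · have h2 : analyticOrderAt (fun y : ℝ => y - a) x = 0 :=
            ((by fun_prop : AnalyticAt ℝ (fun y : ℝ => y - a) x).analyticOrderAt_eq_zero).2
              (sub_ne_zero.2 hxa)
          rwa [h2, zero_add] at h1) (by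
        rw [← Finset.add_sum_erase T _ haT] at hN ⊢
        rw [if_pos rfl, Finset.sum_congr rfl (g := fun x => m x) fun x hx => by
          rw [if_neg (Finset.ne_of_mem_erase hx)]]
        omega)
    refine ⟨a :: l, h', by simp [hl], ?_, hh', ?_⟩
    · simpa [ha1] using hl1
    · rw [List.map_cons, List.prod_cons, mul_assoc]

/-- The coefficientwise pairing of two power series. -/
noncomputable def pairing (u h : ℝ⟦X⟧) : ℝ :=
  ∑' n, coeff n u * coeff n h

section Pairing

variable {ρ : ℝ} {u v w h k φ : ℝ⟦X⟧}

lemma summable_pairing (hρ : 0 < ρ) (hu : AbsSummableAt ρ⁻¹ u) (hh : AbsSummableAt ρ h) :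
    Summable fun n => coeff n u * coeff n h := by
  obtain ⟨B, hB, hb⟩ := hh.exists_bound hρ
  refine Summable.of_norm_bounded (Summable.mul_left B hu) fun n => ?_
  rw [norm_mul, Real.norm_eq_abs, Real.norm_eq_abs]
  calc |coeff n u| * |coeff n h| ≤ |coeff n u| * (B * ρ⁻¹ ^ n) := by
        gcongr
        exact hb n
    _ = _ := by ring

lemma pairing_add_right (hρ : 0 < ρ) (hu : AbsSummableAt ρ⁻¹ u) (hh : AbsSummableAt ρ h)
    (hk : AbsSummableAt ρ k) : pairing u (h + k) = pairing u h + pairing u k := by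
  simp only [pairing, map_add, mul_add]
  exact (summable_pairing hρ hu hh).tsum_add (summable_pairing hρ hu hk)

lemma pairing_C_mul_left (a : ℝ) : pairing (C a * u) h = a * pairing u h := by
  simp only [pairing, coeff_C_mul, mul_assoc, tsum_mul_left]

lemma pairing_C_mul_right (a : ℝ) : pairing u (C a * h) = a * pairing u h := by
  simp only [pairing, coeff_C_mul, mul_left_comm _ a, tsum_mul_left]

lemma pairing_X_mul (hρ : 0 < ρ) (hu : AbsSummableAt ρ⁻¹ u) (hh : AbsSummableAt ρ h) :
    pairing u (X * h) = pairing (mk fun n => coeff (n + 1) u) h := by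
  rw [pairing, (summable_pairing hρ hu (AbsSummableAt.X.mul hρ.le hh)).tsum_eq_zero_add, pairing]
  simp [coeff_succ_X_mul]

lemma pairing_X_mul_X_mul (hρ : 0 < ρ) (hu : AbsSummableAt ρ⁻¹ u) (hh : AbsSummableAt ρ h) :
    pairing (X * u) (X * h) = pairing u h := by
  rw [pairing_X_mul hρ (AbsSummableAt.X.mul (inv_nonneg.2 hρ.le) hu) hh]
  congr 1
  ext n
  simp [coeff_succ_X_mul]

lemma pairing_X_pow_mul (hρ : 0 < ρ) (hu : AbsSummableAt ρ⁻¹ u) (hh : AbsSummableAt ρ h) (n : ℕ) :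
    pairing (X ^ n * u) (X ^ n * h) = pairing u h := by
  induction n with
  | zero => simp
  | succ n ih =>
    rw [pow_succ', mul_assoc, mul_assoc, pairing_X_mul_X_mul hρ
      ((AbsSummableAt.X.pow (inv_nonneg.2 hρ.le) n).mul (inv_nonneg.2 hρ.le) hu)
      ((AbsSummableAt.X.pow hρ.le n).mul hρ.le hh), ih]

lemma pairing_X_sub_C_mul (hρ : 0 < ρ) (hu : AbsSummableAt ρ⁻¹ u) (hh : AbsSummableAt ρ h)
    (x : ℝ) : pairing u ((X - C x) * h) =
      pairing (mk fun n => coeff (n + 1) ((1 - C x * X) * u)) h := by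
  have h1 := summable_pairing hρ (hu.tail (inv_pos.2 hρ)) hh
  have h2 := (summable_pairing hρ hu hh).mul_left x
  rw [sub_mul, sub_eq_add_neg, ← neg_mul, ← map_neg,
    pairing_add_right hρ hu (AbsSummableAt.X.mul hρ.le hh) (hh.C_mul hρ.le _),
    pairing_C_mul_right, pairing_X_mul hρ hu hh, neg_mul, ← sub_eq_add_neg, pairing, pairing,
    ← tsum_mul_left, ← h1.tsum_sub h2, pairing]
  refine tsum_congr fun n => ?_
  rw [coeff_mk, coeff_mk, sub_mul, one_mul, mul_assoc, map_sub, coeff_C_mul, coeff_succ_X_mul]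
  ring

/-- If `∏ (1 - x X) * u` is a polynomial of degree less than the number of factors, then `u` is
orthogonal to every multiple of `∏ (X - x)`. -/
lemma pairing_prod_mul_eq_zero (hρ : 0 < ρ) (l : List ℝ) :
    ∀ {u h : ℝ⟦X⟧}, AbsSummableAt ρ⁻¹ u → AbsSummableAt ρ h →
      (∀ n, l.length ≤ n → coeff n ((l.map fun x => (1 - C x * X : ℝ⟦X⟧)).prod * u) = 0) →
      pairing u ((l.map fun x => (X - C x : ℝ⟦X⟧)).prod * h) = 0 := by
  have hρ' : 0 < ρ⁻¹ := inv_pos.2 hρ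
  induction l with
  | nil =>
    intro u h _ _ h0
    have : u = 0 := by
      ext n
      simpa using h0 n (by simp)
    simp [this, pairing]
  | cons x l ih =>
    intro u h hu hh h0
    have hlin : ∀ x : ℝ, AbsSummableAt ρ (X - C x) := fun x => AbsSummableAt.X.sub hρ.le (.C x)
    have hlin' : AbsSummableAt ρ⁻¹ (1 - C x * X : ℝ⟦X⟧) :=
      AbsSummableAt.one.sub hρ'.le ((AbsSummableAt.C x).mul hρ'.le .X)
    have hprod : AbsSummableAt ρ (l.map fun x => (X - C x : ℝ⟦X⟧)).prod := by
      clear ih h0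
      induction l with
      | nil => simpa using AbsSummableAt.one
      | cons y l ih => simpa using (hlin y).mul hρ.le ih
    rw [List.map_cons, List.prod_cons, mul_assoc,
      pairing_X_sub_C_mul hρ hu (hprod.mul hρ.le hh) x]
    set z := (1 - C x * X) * u with hz
    refine ih ((hlin'.mul hρ'.le hu).tail hρ') hh fun n hn => ?_
    set p := (l.map fun x => (1 - C x * X : ℝ⟦X⟧)).prod with hp
    have hpdeg : ∀ n, l.length < n → coeff n p = 0 := by
      have : p = (((l.map fun x => (1 - Polynomial.C x * Polynomial.X)).prod :
          Polynomial ℝ) : ℝ⟦X⟧) := by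
        rw [hp, ← Polynomial.coeToPowerSeries.ringHom_apply, map_list_prod, List.map_map]
        simp [Function.comp_def]
      intro n hn
      rw [this, Polynomial.coeff_coe]
      refine Polynomial.coeff_eq_zero_of_natDegree_lt (lt_of_le_of_lt ?_ hn)
      refine (Polynomial.natDegree_list_prod_le _).trans ?_
      rw [List.map_map]
      refine (List.sum_le_card_nsmul _ 1 ?_).trans (by simp)
      intro d hd
      obtain ⟨y, -, rfl⟩ := List.mem_map.1 hd
      simp only [Function.comp_apply]
      compute_degree
    have h1 : X * (mk fun n => coeff (n + 1) z) = z - C (coeff 0 z) := by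
      simpa using (sub_const_eq_X_mul_shift z).symm
    have h2 := h0 (n + 1) (by simpa using hn)
    rw [List.map_cons, List.prod_cons, ← hp, mul_comm (1 - _) p, mul_assoc, ← hz] at h2
    rw [← coeff_succ_X_mul, mul_left_comm, h1, mul_sub, map_sub, h2, mul_comm p, coeff_C_mul,
      hpdeg (n + 1) (by omega)]
    simp

lemma summable_hankel (hρ : 0 < ρ) (hu : AbsSummableAt ρ⁻¹ u) (hw : AbsSummableAt ρ⁻¹ w)
    (hφ : AbsSummableAt ρ φ) :
    Summable fun p : ℕ × ℕ => coeff p.1 u * coeff p.2 w * coeff (p.1 + p.2) φ := by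
  obtain ⟨B, hB, hb⟩ := hφ.exists_bound hρ
  have hs := (Summable.mul_of_nonneg hu hw (fun n => by positivity)
    (fun n => by positivity)).mul_left B
  refine Summable.of_norm_bounded hs fun p => ?_
  rw [norm_mul, norm_mul, Real.norm_eq_abs, Real.norm_eq_abs, Real.norm_eq_abs]
  calc |coeff p.1 u| * |coeff p.2 w| * |coeff (p.1 + p.2) φ|
      ≤ |coeff p.1 u| * |coeff p.2 w| * (B * ρ⁻¹ ^ (p.1 + p.2)) := by
        gcongr
        exact hb _
    _ = _ := by
        rw [pow_add]
        ring

lemma pairing_mul_eq_tsum (hρ : 0 < ρ) (hu : AbsSummableAt ρ⁻¹ u) (hw : AbsSummableAt ρ⁻¹ w)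
    (hφ : AbsSummableAt ρ φ) :
    pairing (u * w) φ = ∑' p : ℕ × ℕ, coeff p.1 u * coeff p.2 w * coeff (p.1 + p.2) φ := by
  have hs := summable_hankel hρ hu hw hφ
  symm
  rw [← (Finset.HasAntidiagonal.sigmaAntidiagonalEquivProd (A := ℕ)).tsum_eq]
  refine (Summable.tsum_sigma' (fun n => (hasSum_fintype _).summable)
    ((Finset.HasAntidiagonal.sigmaAntidiagonalEquivProd (A := ℕ)).summable_iff.2 hs)).trans
      (tsum_congr fun n => ?_)
  rw [tsum_fintype, coeff_mul, Finset.sum_mul,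
    ← Finset.sum_coe_sort (Finset.HasAntidiagonal.antidiagonal n)]
  refine Finset.sum_congr rfl fun p _ => ?_
  have := Finset.HasAntidiagonal.mem_antidiagonal.1 p.2
  simp [Finset.HasAntidiagonal.sigmaAntidiagonalEquivProd, this]

lemma pairing_mul_eq_tsum_tsum (hρ : 0 < ρ) (hu : AbsSummableAt ρ⁻¹ u) (hw : AbsSummableAt ρ⁻¹ w)
    (hφ : AbsSummableAt ρ φ) :
    pairing (u * w) φ = ∑' j, coeff j w * ∑' i, coeff i u * coeff (i + j) φ := by
  have hs : Summable fun c : ℕ × ℕ => coeff c.2 u * coeff c.1 w * coeff (c.2 + c.1) φ :=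
    (Equiv.prodComm ℕ ℕ).summable_iff.2 (summable_hankel hρ hu hw hφ)
  rw [pairing_mul_eq_tsum hρ hu hw hφ, ← (Equiv.prodComm ℕ ℕ).tsum_eq]
  refine hs.tsum_prod.trans (tsum_congr fun j => ?_)
  rw [← tsum_mul_left]
  refine tsum_congr fun i => ?_
  ring

end Pairing

section Stieltjes

variable {c : ℕ → ℝ} {G : ℕ → ℝ⟦X⟧} {W f : ℝ⟦X⟧} {ρ : ℝ}

/-- A chain of power series `G` linked by the three-term recurrence of the Stieltjes continued
fraction with positive coefficients `c`, together with the inverse `W` of `G 0`. -/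
structure StieltjesChain (c : ℕ → ℝ) (G : ℕ → ℝ⟦X⟧) (W : ℝ⟦X⟧) : Prop where
  pos : ∀ n, 0 < c n
  coeff_zero : ∀ n, coeff 0 (G n) = 1
  rec_eq : ∀ n, G n = G (n + 1) - C (c n) * X ^ 2 * G (n + 2)
  inv_mul : W * G 0 = 1
  conv : ∀ n, ConvergesOnDisc (G n)
  conv_inv : ConvergesOnDisc W

namespace StieltjesChain

/-- The function of the second kind of index `n` attached to a chain. -/
noncomputable def second (G : ℕ → ℝ⟦X⟧) (W : ℝ⟦X⟧) (n : ℕ) : ℝ⟦X⟧ := X ^ n * (G (n + 1) * W)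

/-- The weights of the sum of squares attached to a chain. -/
noncomputable def weight (c : ℕ → ℝ) (n : ℕ) : ℝ := ∏ i ∈ Finset.range n, c i

lemma weight_succ (c : ℕ → ℝ) (n : ℕ) : weight c (n + 1) = weight c n * c n :=
  Finset.prod_range_succ _ _

lemma weight_pos (h : StieltjesChain c G W) (n : ℕ) : 0 < weight c n :=
  Finset.prod_pos fun i _ => h.pos i

lemma coeff_zero_inv (h : StieltjesChain c G W) : coeff 0 W = 1 := by
  have h0 := h.coeff_zero 0
  have h1 := congrArg (coeff 0) h.inv_mul
  simp only [coeff_zero_eq_constantCoeff, map_mul, map_one] at h0 h1 ⊢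
  rwa [h0, mul_one] at h1

lemma coeff_second_of_lt {n i : ℕ} (hi : i < n) : coeff i (second G W n) = 0 := by
  rw [second, coeff_X_pow_mul', if_neg (by omega)]

lemma coeff_second_self (h : StieltjesChain c G W) (n : ℕ) : coeff n (second G W n) = 1 := by
  rw [second, coeff_X_pow_mul', if_pos le_rfl, Nat.sub_self, coeff_zero_eq_constantCoeff,
    map_mul, ← coeff_zero_eq_constantCoeff, h.coeff_zero, h.coeff_zero_inv, one_mul]

lemma conv_second (h : StieltjesChain c G W) (n : ℕ) : ConvergesOnDisc (second G W n) :=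
  (ConvergesOnDisc.X.pow n).mul ((h.conv _).mul h.conv_inv)

lemma second_succ (h : StieltjesChain c G W) (n : ℕ) :
    second G W (n + 1) = X * (second G W n + C (c (n + 1)) * second G W (n + 2)) := by
  have := h.rec_eq (n + 1)
  simp only [second]
  rw [this]
  ring

lemma second_zero (h : StieltjesChain c G W) :
    second G W 0 = 1 + X * (C (c 0) * second G W 1) := by
  have h1 := h.rec_eq 0
  have h2 : G 1 = G 0 + C (c 0) * X ^ 2 * G 2 := by rw [h1]; ring
  rw [← h.inv_mul, second, second, zero_add, h2]
  ring

lemma coeff_second_succ (h : StieltjesChain c G W) (n i : ℕ) :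
    coeff (i + 1) (second G W (n + 1)) =
      coeff i (second G W n) + c (n + 1) * coeff i (second G W (n + 2)) := by
  rw [h.second_succ, coeff_succ_X_mul, map_add, coeff_C_mul]

lemma coeff_second_zero_succ (h : StieltjesChain c G W) (i : ℕ) :
    coeff (i + 1) (second G W 0) = c 0 * coeff i (second G W 1) := by
  rw [h.second_zero, map_add, coeff_succ_X_mul, coeff_C_mul, coeff_one]
  simp

/-- A Christoffel–Darboux identity for the functions of the second kind. -/
lemma sum_weight_sub (h : StieltjesChain c G W) (i j M : ℕ) :
    ∑ n ∈ Finset.range (M + 1), weight c n *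
      (coeff (i + 1) (second G W n) * coeff j (second G W n) -
        coeff i (second G W n) * coeff (j + 1) (second G W n)) =
    weight c (M + 1) * (coeff i (second G W (M + 1)) * coeff j (second G W M) -
      coeff i (second G W M) * coeff j (second G W (M + 1))) := by
  induction M with
  | zero =>
    rw [Finset.sum_range_one, h.coeff_second_zero_succ, h.coeff_second_zero_succ, weight_succ]
    ring
  | succ M ih =>
    rw [Finset.sum_range_succ, ih, h.coeff_second_succ, h.coeff_second_succ, weight_succ _ (M + 1)]
    ring

lemma coeff_add_eq_sum (h : StieltjesChain c G W) {i j M : ℕ} (hM : i + j < M) :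
    coeff (i + j) (G 1 * W) = ∑ n ∈ Finset.range M,
      weight c n * (coeff i (second G W n) * coeff j (second G W n)) := by
  obtain ⟨M, rfl⟩ : ∃ M', M = M' + 1 := ⟨M - 1, by omega⟩
  induction i generalizing j with
  | zero =>
    rw [Finset.sum_eq_single_of_mem 0 (by simp)]
    · rw [h.coeff_second_self]
      simp [weight, second]
    · intro n _ hn
      rw [coeff_second_of_lt (Nat.pos_of_ne_zero hn)]
      ring
  | succ i ih =>
    have h1 := h.sum_weight_sub i j M
    rw [coeff_second_of_lt (i := i) (n := M + 1) (by omega),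
      coeff_second_of_lt (i := j) (n := M + 1) (by omega)] at h1
    simp only [mul_sub, Finset.sum_sub_distrib] at h1
    rw [show i + 1 + j = i + (j + 1) by ring, ih (by omega)]
    linarith

lemma coeff_add_eq_sum_range (h : StieltjesChain c G W) (i j : ℕ) :
    coeff (i + j) (G 1 * W) = ∑ n ∈ Finset.range (j + 1),
      weight c n * (coeff i (second G W n) * coeff j (second G W n)) := by
  rw [h.coeff_add_eq_sum (Nat.lt_succ_self (i + j))]
  symm
  refine Finset.sum_subset (Finset.range_mono (by omega)) fun n _ hn => ?_
  rw [coeff_second_of_lt (i := j) (by simpa using hn)]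
  ring

/-- Bessel's inequality for the quadratic form with the coefficients of `G 1 / G 0` as moments. -/
lemma weight_mul_pairing_sq_le (h : StieltjesChain c G W) (hρ : 0 < ρ) (hρ1 : ρ < 1)
    (hf : AbsSummableAt ρ⁻¹ f) (n : ℕ) :
    weight c n * pairing f (second G W n) ^ 2 ≤ pairing (f * f) (G 1 * W) := by
  have hφ : AbsSummableAt ρ (G 1 * W) := ((h.conv 1).mul h.conv_inv) ρ hρ hρ1
  rw [pairing_mul_eq_tsum hρ hf hf hφ]
  have hs := summable_hankel hρ hf hf hφ
  have ht : Tendsto (fun L => Finset.range L ×ˢ Finset.range L) atTop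
      (atTop : Filter (Finset (ℕ × ℕ))) := by
    refine tendsto_atTop_finset_of_monotone
      (fun a b hab => Finset.product_subset_product (Finset.range_mono hab)
        (Finset.range_mono hab)) fun p => ⟨p.1 + p.2 + 1, ?_⟩
    simp only [Finset.mem_product, Finset.mem_range]
    omega
  have h1 := hs.hasSum.comp ht
  have h2 : Tendsto (fun L => weight c n *
      (∑ i ∈ Finset.range L, coeff i f * coeff i (second G W n)) ^ 2) atTop
      (𝓝 (weight c n * pairing f (second G W n) ^ 2)) :=
    (((summable_pairing hρ hf (h.conv_second n ρ hρ hρ1)).hasSum.tendsto_sum_nat).pow 2).const_mul _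
  refine le_of_tendsto_of_tendsto h2 h1 ?_
  filter_upwards [eventually_gt_atTop n] with L hL
  have h3 : ∑ p ∈ Finset.range L ×ˢ Finset.range L,
      coeff p.1 f * coeff p.2 f * coeff (p.1 + p.2) (G 1 * W) =
      ∑ n ∈ Finset.range (2 * L), weight c n *
        (∑ i ∈ Finset.range L, coeff i f * coeff i (second G W n)) ^ 2 := by
    simp only [sq, Finset.sum_mul_sum, ← Finset.sum_product']
    simp only [Finset.mul_sum]
    rw [Finset.sum_comm]
    refine Finset.sum_congr rfl fun p hp => ?_
    simp only [Finset.mem_product, Finset.mem_range] at hp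
    rw [h.coeff_add_eq_sum (M := 2 * L) (by omega), Finset.mul_sum]
    refine Finset.sum_congr rfl fun n _ => ?_
    ring
  simp only [Function.comp_apply]
  rw [h3]
  exact Finset.single_le_sum (f := fun n => weight c n *
    (∑ i ∈ Finset.range L, coeff i f * coeff i (second G W n)) ^ 2)
    (fun n _ => mul_nonneg (h.weight_pos n).le (sq_nonneg _)) (by simp; omega)

lemma pairing_second_eq_zero (h : StieltjesChain c G W) (hρ : 0 < ρ) (hρ1 : ρ < 1)
    (hf : AbsSummableAt ρ⁻¹ f) (h0 : pairing (f * f) (G 1 * W) = 0) (n : ℕ) :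
    pairing f (second G W n) = 0 := by
  have h1 := h.weight_mul_pairing_sq_le hρ hρ1 hf n
  rw [h0] at h1
  have h2 := h.weight_pos n
  exact pow_eq_zero_iff two_ne_zero |>.1
    (le_antisymm (nonpos_of_mul_nonpos_right h1 h2) (sq_nonneg _))

/-- The radical of the moment form: isotropic series are orthogonal to everything. -/
lemma pairing_mul_eq_zero (h : StieltjesChain c G W) (hρ : 0 < ρ) (hρ1 : ρ < 1) {w : ℝ⟦X⟧}
    (hf : AbsSummableAt ρ⁻¹ f) (hw : AbsSummableAt ρ⁻¹ w)
    (h0 : pairing (f * f) (G 1 * W) = 0) : pairing (f * w) (G 1 * W) = 0 := by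
  have hφ : AbsSummableAt ρ (G 1 * W) := ((h.conv 1).mul h.conv_inv) ρ hρ hρ1
  rw [pairing_mul_eq_tsum_tsum hρ hf hw hφ]
  have : ∀ j, ∑' i, coeff i f * coeff (i + j) (G 1 * W) = 0 := fun j => by
    simp only [h.coeff_add_eq_sum_range _ j, Finset.mul_sum]
    rw [Summable.tsum_finsetSum]
    · refine Finset.sum_eq_zero fun n _ => ?_
      have h1 := h.pairing_second_eq_zero hρ hρ1 hf h0 n
      rw [pairing] at h1
      rw [← mul_zero (weight c n * coeff j (second G W n)), ← h1, ← tsum_mul_left]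
      exact tsum_congr fun i => by ring
    · intro n _
      exact ((summable_pairing hρ hf (h.conv_second n ρ hρ hρ1)).mul_left
        (weight c n * coeff j (second G W n))).congr fun i => by ring
  simp [this]

/-- The moment form is positive definite on polynomials. -/
lemma eq_zero_of_pairing_sq_eq_zero (h : StieltjesChain c G W) (p : Polynomial ℝ)
    (h0 : pairing ((p : ℝ⟦X⟧) * p) (G 1 * W) = 0) : p = 0 := by
  have h1 := h.pairing_second_eq_zero (ρ := 1 / 2) (by norm_num) (by norm_num) (.coe p) h0
    p.natDegree
  rw [pairing, tsum_eq_single p.natDegree, h.coeff_second_self, Polynomial.coeff_coe] at h1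
  · simpa using h1
  · intro n hn
    rcases lt_or_gt_of_ne hn with hn | hn
    · rw [coeff_second_of_lt hn, mul_zero]
    · rw [Polynomial.coeff_coe, Polynomial.coeff_eq_zero_of_natDegree_lt hn, zero_mul]

end StieltjesChain

end Stieltjes

section InvSqrt

/-- The coefficients of the power series of `1 / √(1 - X)`. -/
noncomputable def binomHalf (n : ℕ) : ℝ := n.centralBinom / 4 ^ n

lemma binomHalf_zero : binomHalf 0 = 1 := by simp [binomHalf]

lemma binomHalf_succ (n : ℕ) : binomHalf (n + 1) * (n + 1) = binomHalf n * (n + 1 / 2) := by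
  have h : ((n + 1 : ℕ) : ℝ) * (n + 1).centralBinom = (2 * (2 * n + 1) * n.centralBinom : ℕ) := by
    exact_mod_cast Nat.succ_mul_centralBinom_succ n
  push_cast at h
  rw [binomHalf, binomHalf, pow_succ, div_mul_eq_mul_div, div_mul_eq_mul_div,
    div_eq_div_iff (by positivity) (by positivity)]
  linear_combination 4 ^ n * h

lemma binomHalf_pos (n : ℕ) : 0 < binomHalf n :=
  div_pos (by exact_mod_cast n.centralBinom_pos) (by positivity)

lemma binomHalf_le_one (n : ℕ) : binomHalf n ≤ 1 :=
  div_le_one_of_le₀ (by exact_mod_cast n.centralBinom_le_four_pow) (by positivity)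

/-- The power series of `1 / √(1 - x X)`. -/
noncomputable def invSqrt (x : ℝ) : ℝ⟦X⟧ := mk fun n => binomHalf n * x ^ n

lemma one_sub_mul_derivative_invSqrt (x : ℝ) :
    (1 - C x * X) * d⁄dX ℝ (invSqrt x) = C (x / 2) * invSqrt x := by
  ext n
  rw [sub_mul, one_mul, mul_assoc, map_sub, coeff_C_mul, coeff_C_mul, coeff_derivative, invSqrt,
    coeff_mk, coeff_mk]
  rcases n with _ | n
  · have := binomHalf_succ 0
    simp at this ⊢
    linear_combination x * this
  · rw [coeff_succ_X_mul, coeff_derivative, coeff_mk]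
    have := binomHalf_succ (n + 1)
    push_cast at this ⊢
    linear_combination x ^ (n + 2) * this

lemma invSqrt_sq_mul (x : ℝ) : invSqrt x * invSqrt x * (1 - C x * X) = 1 := by
  refine derivative.ext ?_ ?_
  · have h := one_sub_mul_derivative_invSqrt x
    simp only [Derivation.leibniz, smul_eq_mul, map_sub, derivative_C, derivative_X,
      derivative_one, mul_zero, add_zero, mul_one, zero_sub]
    have h2 : (2 : ℝ⟦X⟧) * C (x / 2) = C x := by
      rw [← map_ofNat C, ← map_mul]
      congr 1
      ring
    linear_combination 2 * invSqrt x * h + invSqrt x ^ 2 * h2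
  · rw [← coeff_zero_eq_constantCoeff_apply]
    simp [invSqrt, binomHalf_zero]

lemma AbsSummableAt.invSqrt {x ρ : ℝ} (hρ : 0 < ρ) (h : |x| < ρ) :
    AbsSummableAt ρ⁻¹ (invSqrt x) := by
  have h1 : |x| * ρ⁻¹ < 1 := by
    rwa [← div_eq_mul_inv, div_lt_one hρ]
  refine Summable.of_nonneg_of_le (fun n => by positivity) (fun n => ?_)
    (summable_geometric_of_lt_one (by positivity) h1)
  rw [_root_.invSqrt, coeff_mk, abs_mul, abs_pow, abs_of_pos (binomHalf_pos n), mul_pow, mul_assoc]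
  exact mul_le_of_le_one_left (by positivity) (binomHalf_le_one n)

lemma exists_sq_mul_prod_eq_one {ρ : ℝ} (hρ : 0 < ρ) (l : List ℝ) (hl : ∀ x ∈ l, |x| < ρ) :
    ∃ v : ℝ⟦X⟧, AbsSummableAt ρ⁻¹ v ∧
      v * v * (l.map fun x => (1 - C x * X : ℝ⟦X⟧)).prod = 1 := by
  induction l with
  | nil => exact ⟨1, .one, by simp⟩
  | cons x l ih =>
    obtain ⟨v, hv, h⟩ := ih fun y hy => hl y (List.mem_cons_of_mem _ hy)
    refine ⟨invSqrt x * v,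
      (AbsSummableAt.invSqrt hρ (hl x List.mem_cons_self)).mul (inv_nonneg.2 hρ.le) hv, ?_⟩
    rw [List.map_cons, List.prod_cons]
    calc _ = (invSqrt x * invSqrt x * (1 - C x * X)) *
          (v * v * (l.map fun x => (1 - C x * X : ℝ⟦X⟧)).prod) := by ring
      _ = 1 := by rw [h, invSqrt_sq_mul, one_mul]

end InvSqrt

lemma pairing_comm (u h : ℝ⟦X⟧) : pairing u h = pairing h u :=
  tsum_congr fun _ => mul_comm _ _

lemma pairing_add_left {ρ : ℝ} {u v h : ℝ⟦X⟧} (hρ : 0 < ρ) (hu : AbsSummableAt ρ⁻¹ u)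
    (hv : AbsSummableAt ρ⁻¹ v) (hh : AbsSummableAt ρ h) :
    pairing (u + v) h = pairing u h + pairing v h := by
  simp only [pairing_comm _ h]
  rw [← inv_inv ρ] at hh
  exact pairing_add_right (inv_pos.2 hρ) hh hu hv

/-- Multiplication by a polynomial is adjoint to multiplication by the reversed polynomial. -/
lemma pairing_coe_mul {ρ : ℝ} {z φ : ℝ⟦X⟧} (hρ : 0 < ρ) (hz : AbsSummableAt ρ⁻¹ z)
    (hφ : AbsSummableAt ρ φ) {D : ℕ} (p : Polynomial ℝ) (hp : p.natDegree ≤ D) :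
    pairing (X ^ D * z) (p * φ) = pairing ((p.reflect D : Polynomial ℝ) * z) φ := by
  have hρ' : 0 < ρ⁻¹ := inv_pos.2 hρ
  have hXz : AbsSummableAt ρ⁻¹ (X ^ D * z) := (AbsSummableAt.X.pow hρ'.le D).mul hρ'.le hz
  refine Polynomial.induction_with_natDegree_le (fun p : Polynomial ℝ =>
    pairing (X ^ D * z) (p * φ) = pairing ((p.reflect D : Polynomial ℝ) * z) φ) D ?_ ?_ ?_ p hp
  · simp [pairing]
  · intro n a _ hn
    rw [Polynomial.reflect_C_mul_X_pow, Polynomial.revAt_le hn]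
    simp only [Polynomial.coe_mul, Polynomial.coe_C, Polynomial.coe_pow, Polynomial.coe_X,
      mul_assoc, pairing_C_mul_left, pairing_C_mul_right]
    obtain ⟨e, rfl⟩ := Nat.exists_eq_add_of_le hn
    rw [Nat.add_sub_cancel_left, pow_add, mul_assoc, pairing_X_pow_mul hρ
      ((AbsSummableAt.X.pow hρ'.le e).mul hρ'.le hz) hφ]
  · intro f g _ _ hf hg
    rw [Polynomial.reflect_add, Polynomial.coe_add, Polynomial.coe_add, add_mul, add_mul,
      pairing_add_right hρ hXz ((AbsSummableAt.coe f).mul hρ.le hφ)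
        ((AbsSummableAt.coe g).mul hρ.le hφ),
      pairing_add_left hρ ((AbsSummableAt.coe _).mul hρ'.le hz)
        ((AbsSummableAt.coe _).mul hρ'.le hz) hφ, hf, hg]

lemma List.exists_abs_lt_lt_one (l : List ℝ) (hl : ∀ x ∈ l, |x| < 1) :
    ∃ ρ : ℝ, 0 < ρ ∧ ρ < 1 ∧ ∀ x ∈ l, |x| < ρ := by
  induction l with
  | nil => exact ⟨1 / 2, by norm_num, by norm_num, by simp⟩
  | cons y l ih =>
    obtain ⟨ρ, h0, h1, h⟩ := ih fun x hx => hl x (List.mem_cons_of_mem _ hx)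
    obtain ⟨σ, h2, h3⟩ := exists_between (max_lt h1 (hl y List.mem_cons_self))
    refine ⟨σ, h0.trans ((le_max_left _ _).trans_lt h2), h3, fun x hx => ?_⟩
    rcases List.mem_cons.1 hx with rfl | hx
    · exact (le_max_right _ _).trans_lt h2
    · exact (h x hx).trans ((le_max_left _ _).trans_lt h2)

/-- A combination `A G₀ + X² B G₁` with polynomials of degree at most `D` that vanishes to total
order greater than `2 D + 2` on the unit interval is trivial. -/
lemma StieltjesChain.eq_zero_of_order {c : ℕ → ℝ} {G : ℕ → ℝ⟦X⟧} {W : ℝ⟦X⟧}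
    (h : StieltjesChain c G W) {A B : Polynomial ℝ} {D : ℕ} (hA : A.natDegree ≤ D)
    (hB : B.natDegree ≤ D) {T : Finset ℝ} (hT : ∀ x ∈ T, |x| < 1) {m : ℝ → ℕ}
    (hm : ∀ x ∈ T, (m x : ℕ∞) ≤
      analyticOrderAt (seriesSum ((A : ℝ⟦X⟧) * G 0 + X ^ 2 * (B : ℝ⟦X⟧) * G 1)) x)
    (hN : 2 * D + 2 < ∑ x ∈ T, m x) : A = 0 ∧ B = 0 := by
  have hconv : ConvergesOnDisc ((A : ℝ⟦X⟧) * G 0 + X ^ 2 * (B : ℝ⟦X⟧) * G 1) :=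
    ((ConvergesOnDisc.coe A).mul (h.conv 0)).add
      (((ConvergesOnDisc.X.pow 2).mul (.coe B)).mul (h.conv 1))
  obtain ⟨l, H', hlen, hl, hH', heq⟩ := hconv.exists_eq_prod_mul T hT _ hm rfl
  obtain ⟨ρ, hρ, hρ1, hlρ⟩ := List.exists_abs_lt_lt_one l hl
  have hρ' : 0 < ρ⁻¹ := inv_pos.2 hρ
  obtain ⟨v, hv, hv1⟩ := exists_sq_mul_prod_eq_one hρ l hlρ
  set ω := (l.map fun x => (X - C x : ℝ⟦X⟧)).prod
  set Ω := (l.map fun x => (1 - C x * X : ℝ⟦X⟧)).prod with hΩ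
  have hH : AbsSummableAt ρ (H' * W) := (hH'.mul h.conv_inv) ρ hρ hρ1
  have hφ : AbsSummableAt ρ (G 1 * W) := ((h.conv 1).mul h.conv_inv) ρ hρ hρ1
  have hvv : AbsSummableAt ρ⁻¹ (v * v) := hv.mul hρ'.le hv
  have hfac : (A : ℝ⟦X⟧) + X ^ 2 * ((B : ℝ⟦X⟧) * (G 1 * W)) = ω * (H' * W) := by
    linear_combination W * heq - A * h.inv_mul
  have horth : ∀ q : Polynomial ℝ, q.natDegree < l.length →
      pairing ((q : ℝ⟦X⟧) * (v * v)) (ω * (H' * W)) = 0 := by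
    intro q hq
    refine pairing_prod_mul_eq_zero hρ l ((AbsSummableAt.coe q).mul hρ'.le hvv) hH fun n hn => ?_
    rw [← hΩ, show Ω * (q * (v * v)) = q * (v * v * Ω) by ring, hv1, mul_one,
      Polynomial.coeff_coe]
    exact Polynomial.coeff_eq_zero_of_natDegree_lt (by omega)
  have hB0 : B = 0 := by
    set R := B.reflect D
    have hR : R.natDegree ≤ D := (Polynomial.natDegree_reflect_le).trans (by simp [hB])
    have hz : AbsSummableAt ρ⁻¹ ((R : ℝ⟦X⟧) * (v * v)) := (AbsSummableAt.coe R).mul hρ'.le hvv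
    have h1 := horth (Polynomial.X ^ (2 + D) * R) (by
      refine Polynomial.natDegree_mul_le.trans_lt ?_
      rw [Polynomial.natDegree_X_pow]
      omega)
    rw [← hfac, Polynomial.coe_mul, Polynomial.coe_pow, Polynomial.coe_X, mul_assoc,
      pairing_add_right hρ ((AbsSummableAt.X.pow hρ'.le _).mul hρ'.le hz) (.coe A)
        ((AbsSummableAt.X.pow hρ.le 2).mul hρ.le ((AbsSummableAt.coe B).mul hρ.le hφ)),
      pow_add, mul_assoc, pairing_X_pow_mul hρ ((AbsSummableAt.X.pow hρ'.le _).mul hρ'.le hz)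
        ((AbsSummableAt.coe B).mul hρ.le hφ), pairing_coe_mul hρ hz hφ B hB] at h1
    have h2 : pairing (X ^ 2 * (X ^ D * ((R : ℝ⟦X⟧) * (v * v)))) (A : ℝ⟦X⟧) = 0 := by
      rw [← mul_assoc, ← pow_add, pairing]
      refine (tsum_congr fun n => ?_).trans tsum_zero
      rw [coeff_X_pow_mul', Polynomial.coeff_coe]
      split_ifs with hn
      · rw [Polynomial.coeff_eq_zero_of_natDegree_lt (by omega), mul_zero]
      · rw [zero_mul]
    rw [h2, zero_add, show (R : ℝ⟦X⟧) * ((R : ℝ⟦X⟧) * (v * v)) = R * v * (R * v) by ring] at h1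
    have hf : AbsSummableAt ρ⁻¹ ((R : ℝ⟦X⟧) * v) := (AbsSummableAt.coe R).mul hρ'.le hv
    have hΩs : AbsSummableAt ρ⁻¹ Ω := by
      have : Ω = (((l.map fun x => (1 - Polynomial.C x * Polynomial.X)).prod :
          Polynomial ℝ) : ℝ⟦X⟧) := by
        rw [hΩ, ← Polynomial.coeToPowerSeries.ringHom_apply, map_list_prod, List.map_map]
        simp [Function.comp_def]
      rw [this]
      exact .coe _
    have h3 := h.pairing_mul_eq_zero hρ hρ1 hf (hf.mul hρ'.le hΩs) h1
    rw [show (R : ℝ⟦X⟧) * v * ((R : ℝ⟦X⟧) * v * Ω) = R * R * (v * v * Ω) by ring, hv1,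
      mul_one] at h3
    exact Polynomial.reflect_eq_zero_iff.1 (h.eq_zero_of_pairing_sq_eq_zero R h3)
  refine ⟨?_, hB0⟩
  have h1 := horth (Polynomial.X ^ A.natDegree) (by rw [Polynomial.natDegree_X_pow]; omega)
  rw [← hfac, hB0, Polynomial.coe_zero, zero_mul, mul_zero, add_zero, pairing,
    tsum_eq_single A.natDegree] at h1
  · have h2 := congrArg constantCoeff hv1
    have h3 : constantCoeff Ω = 1 := by
      rw [hΩ, map_list_prod, List.map_map]
      refine List.prod_eq_one fun x hx => ?_
      obtain ⟨y, -, rfl⟩ := List.mem_map.1 hx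
      simp
    rw [map_mul, h3, mul_one, map_one] at h2
    rw [Polynomial.coe_pow, Polynomial.coe_X, coeff_X_pow_mul', if_pos le_rfl, Nat.sub_self,
      coeff_zero_eq_constantCoeff_apply, h2, one_mul, Polynomial.coeff_coe] at h1
    simpa using h1
  · intro n hn
    rw [Polynomial.coe_pow, Polynomial.coe_X, coeff_X_pow_mul', Polynomial.coeff_coe]
    split_ifs with hle
    · rw [Polynomial.coeff_eq_zero_of_natDegree_lt (by omega), mul_zero]
    · rw [zero_mul]

/-- **Kaluza's theorem**, in a quantitative form: the reciprocal of a series with log-convex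
coefficients has nonpositive coefficients beyond the constant one. -/
lemma coeff_inverse_of_logConvex {a w : ℝ⟦X⟧} (ha0 : coeff 0 a = 1) (hpos : ∀ n, 0 < coeff n a)
    (hlc : ∀ i n, i ≤ n → coeff (i + 1) a * coeff n a ≤ coeff (n + 1) a * coeff i a)
    (hw : w * a = 1) (n : ℕ) : coeff (n + 1) w ≤ 0 ∧ -coeff (n + 1) a ≤ coeff (n + 1) w := by
  have hw0 : coeff 0 w = 1 := by
    have h1 := congrArg (coeff 0) hw
    simp only [coeff_zero_eq_constantCoeff, map_mul, map_one] at ha0 h1 ⊢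
    rwa [ha0, mul_one] at h1
  have hconv : ∀ n, coeff (n + 1) w = -coeff (n + 1) a -
      ∑ i ∈ Finset.range n, coeff (i + 1) w * coeff (n - i) a := by
    intro n
    have h1 := congrArg (coeff (n + 1)) hw
    rw [coeff_mul, Finset.Nat.sum_antidiagonal_eq_sum_range_succ_mk, Finset.sum_range_succ,
      Finset.sum_range_succ', coeff_one, if_neg (by omega)] at h1
    simp only [Nat.sub_self, Nat.sub_zero, ha0, hw0, Nat.add_sub_add_right] at h1
    linarith
  have hneg : ∀ n, coeff (n + 1) w ≤ 0 := by
    intro n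
    induction n using Nat.strong_induction_on with
    | _ n ih =>
      rcases n with _ | n
      · have := hconv 0
        have h1 := hpos 1
        simp at this ⊢
        linarith
      · have h1 := hconv n
        have h2 := hconv (n + 1)
        rw [Finset.sum_range_succ] at h2
        rw [Nat.add_sub_cancel_left] at h2
        have h3 := hpos (n + 1)
        have h4 : coeff (n + 1) a * coeff (n + 1 + 1) w =
            ∑ i ∈ Finset.range (n + 1), coeff (i + 1) w *
              (coeff (n + 2) a * coeff (n - i) a - coeff (n - i + 1) a * coeff (n + 1) a) := by
          have h5 : ∑ i ∈ Finset.range (n + 1), coeff (i + 1) w *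
              (coeff (n + 2) a * coeff (n - i) a - coeff (n - i + 1) a * coeff (n + 1) a) =
              coeff (n + 2) a * ∑ i ∈ Finset.range (n + 1), coeff (i + 1) w * coeff (n - i) a -
              coeff (n + 1) a *
                ∑ i ∈ Finset.range (n + 1), coeff (i + 1) w * coeff (n + 1 - i) a := by
            rw [Finset.mul_sum, Finset.mul_sum, ← Finset.sum_sub_distrib]
            refine Finset.sum_congr rfl fun i hi => ?_
            rw [Nat.sub_add_comm (by simpa [Nat.lt_succ_iff] using hi)]
            ring
          rw [h5, Finset.sum_range_succ _ n, Finset.sum_range_succ _ n, Nat.sub_self, ha0,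
            Nat.add_sub_cancel_left]
          linear_combination coeff (n + 1) a * h2 - coeff (n + 2) a * h1
        refine nonpos_of_mul_nonpos_right (h4.trans_le (Finset.sum_nonpos fun i hi => ?_)) h3
        refine mul_nonpos_of_nonpos_of_nonneg (ih i (Finset.mem_range.1 hi)) ?_
        have := hlc (n - i) (n + 1) (by omega)
        linarith
  refine ⟨hneg n, ?_⟩
  rw [hconv n]
  have : ∑ i ∈ Finset.range n, coeff (i + 1) w * coeff (n - i) a ≤ 0 :=
    Finset.sum_nonpos fun i _ => mul_nonpos_of_nonpos_of_nonneg (hneg i) (hpos _).le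
  linarith

section Hypergeometric

/-- The coefficients of the Gauss hypergeometric series with parameters `a, b; c`. -/
noncomputable def hypCoeff (a b c : ℝ) : ℕ → ℝ
  | 0 => 1
  | n + 1 => hypCoeff a b c n * ((a + n) * (b + n) / ((c + n) * (n + 1)))

lemma hypCoeff_symm (a b c : ℝ) (n : ℕ) : hypCoeff a b c n = hypCoeff b a c n := by
  induction n with
  | zero => rfl
  | succ n ih => rw [hypCoeff, hypCoeff, ih, mul_comm (a + n)]

lemma hypCoeff_add_one {b c : ℝ} (a : ℝ) (hb : 0 < b) (hc : 0 < c) (n : ℕ) :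
    b * (c + n) * hypCoeff a (b + 1) (c + 1) n = (b + n) * c * hypCoeff a b c n := by
  induction n with
  | zero => simp [hypCoeff]
  | succ n ih =>
    have ih' : hypCoeff a (b + 1) (c + 1) n =
        (b + n) * c * hypCoeff a b c n / (b * (c + n)) := by
      rw [← ih]
      field_simp
    rw [hypCoeff, hypCoeff, ih']
    push_cast
    field_simp
    ring

lemma hypCoeff_add_two {a b c : ℝ} (ha : 0 < a) (hb : 0 < b) (hc : 0 < c) (n : ℕ) :
    a * b * (c + n + 1) * hypCoeff (a + 1) (b + 1) (c + 2) n =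
      (n + 1) * c * (c + 1) * hypCoeff a b c (n + 1) := by
  induction n with
  | zero =>
    simp [hypCoeff]
    field_simp
  | succ n ih =>
    have ih' : hypCoeff (a + 1) (b + 1) (c + 2) n =
        (n + 1) * c * (c + 1) * hypCoeff a b c (n + 1) / (a * b * (c + n + 1)) := by
      rw [← ih]
      field_simp
    rw [hypCoeff, hypCoeff.eq_2 a b c (n + 1), ih']
    push_cast
    field_simp
    ring

/-- A contiguous relation between hypergeometric series. -/
lemma hypCoeff_contiguous {a b c : ℝ} (ha : 0 < a) (hb : 0 < b) (hc : 0 < c) (n : ℕ) :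
    hypCoeff a b c (n + 1) = hypCoeff a (b + 1) (c + 1) (n + 1) -
      a * (c - b) / (c * (c + 1)) * hypCoeff (a + 1) (b + 1) (c + 2) n := by
  have h1 := hypCoeff_add_one a hb hc (n + 1)
  have h2 := hypCoeff_add_two ha hb hc n
  push_cast at h1
  have h3 : hypCoeff a (b + 1) (c + 1) (n + 1) =
      (b + (n + 1)) * c * hypCoeff a b c (n + 1) / (b * (c + (n + 1))) := by
    rw [← h1]
    field_simp
  have h4 : hypCoeff (a + 1) (b + 1) (c + 2) n =
      (n + 1) * c * (c + 1) * hypCoeff a b c (n + 1) / (a * b * (c + n + 1)) := by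
    rw [← h2]
    field_simp
  rw [h3, h4]
  field_simp
  ring

/-- The upper parameters of the chain of hypergeometric series attached to `K` and `E`. -/
noncomputable def chainParam (n : ℕ) : ℝ := (n / 2 : ℕ) + 1 / 2

lemma chainParam_pos (n : ℕ) : 0 < chainParam n := by
  unfold chainParam
  positivity

lemma chainParam_add_two (n : ℕ) : chainParam (n + 2) = chainParam n + 1 := by
  rw [chainParam, chainParam, Nat.add_div_right _ two_pos]
  push_cast
  ring

lemma chainParam_add (n : ℕ) : chainParam n + chainParam (n + 1) = n + 1 := by
  have h : n / 2 + (n + 1) / 2 = n := by omega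
  have h' : ((n / 2 : ℕ) : ℝ) + ((n + 1) / 2 : ℕ) = n := by exact_mod_cast h
  rw [chainParam, chainParam]
  linarith

/-- The chain of hypergeometric series attached to `K` and `E`, in the variable `k ^ 2`. -/
noncomputable def hypChain (n : ℕ) : ℝ⟦X⟧ :=
  mk (hypCoeff (chainParam (n + 1)) (chainParam n) (n + 1))

/-- The coefficients of the continued fraction attached to `K` and `E`. -/
noncomputable def chainCoeff (n : ℕ) : ℝ := chainParam (n + 1) ^ 2 / ((n + 1) * (n + 2))

lemma chainCoeff_pos (n : ℕ) : 0 < chainCoeff n := by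
  have := chainParam_pos (n + 1)
  unfold chainCoeff
  positivity

lemma hypChain_rec (n : ℕ) :
    hypChain n = hypChain (n + 1) - C (chainCoeff n) * X * hypChain (n + 2) := by
  ext i
  rw [map_sub, mul_assoc, coeff_C_mul, hypChain, hypChain, hypChain, coeff_mk, coeff_mk]
  rcases i with _ | i
  · simp [hypCoeff]
  · rw [coeff_succ_X_mul, coeff_mk, hypCoeff_contiguous (chainParam_pos _) (chainParam_pos _)
      (by positivity), show n + 2 + 1 = n + 1 + 2 by ring, chainParam_add_two, chainParam_add_two]
    have h := chainParam_add n
    rw [hypCoeff_symm (chainParam n + 1) _ _ (i + 1), chainCoeff,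
      show (n : ℝ) + 1 - chainParam n = chainParam (n + 1) by linarith]
    push_cast
    rw [show (n : ℝ) + 1 + 1 = n + 2 by ring, show (n : ℝ) + 1 + 2 = n + 2 + 1 by ring]
    ring

/-- The power series of `2 K / π` in the variable `k ^ 2`. -/
noncomputable def kSeries : ℝ⟦X⟧ := mk fun n => binomHalf n ^ 2

/-- The power series of `2 (K - E) / (π k ^ 2)` in the variable `k ^ 2`. -/
noncomputable def jSeries : ℝ⟦X⟧ := mk fun n => binomHalf n * binomHalf (n + 1)

lemma binomHalf_succ_eq (n : ℕ) : binomHalf (n + 1) = binomHalf n * ((n + 1 / 2) / (n + 1)) := by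
  have := binomHalf_succ n
  field_simp at this ⊢
  linarith

lemma hypChain_zero : hypChain 0 = kSeries := by
  ext n
  rw [hypChain, kSeries, coeff_mk, coeff_mk]
  induction n with
  | zero => simp [hypCoeff, binomHalf_zero]
  | succ n ih =>
    rw [hypCoeff, ih, binomHalf_succ_eq]
    simp [chainParam]
    field_simp
    ring

lemma hypChain_one : hypChain 1 = C 2 * jSeries := by
  ext n
  rw [hypChain, jSeries, coeff_C_mul, coeff_mk, coeff_mk]
  induction n with
  | zero =>
    have := binomHalf_succ 0
    simp [hypCoeff, binomHalf_zero] at this ⊢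
    rw [this]
    norm_num
  | succ n ih =>
    rw [hypCoeff, ih, binomHalf_succ_eq (n + 1), binomHalf_succ_eq n]
    simp [chainParam]
    field_simp
    ring

lemma conv_kSeries : ConvergesOnDisc kSeries :=
  ConvergesOnDisc.of_bounded (B := 1) fun n => by
    rw [kSeries, coeff_mk, abs_of_pos (pow_pos (binomHalf_pos n) 2)]
    exact pow_le_one₀ (binomHalf_pos n).le (binomHalf_le_one n)

lemma conv_jSeries : ConvergesOnDisc jSeries :=
  ConvergesOnDisc.of_bounded (B := 1) fun n => by
    rw [jSeries, coeff_mk, abs_of_pos (mul_pos (binomHalf_pos _) (binomHalf_pos _))]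
    exact mul_le_one₀ (binomHalf_le_one _) (binomHalf_pos _).le (binomHalf_le_one _)

lemma conv_hypChain (n : ℕ) : ConvergesOnDisc (hypChain n) := by
  suffices ∀ n, ConvergesOnDisc (hypChain n) ∧ ConvergesOnDisc (hypChain (n + 1)) from (this n).1
  intro n
  induction n with
  | zero =>
    rw [zero_add, hypChain_zero, hypChain_one]
    exact ⟨conv_kSeries, (ConvergesOnDisc.C 2).mul conv_jSeries⟩
  | succ n ih =>
    refine ⟨ih.2, fun ρ h0 h1 => AbsSummableAt.of_X_mul h0 ?_⟩
    have h := hypChain_rec n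
    have hc := (chainCoeff_pos n).ne'
    have : X * hypChain (n + 1 + 1) =
        C (chainCoeff n)⁻¹ * (hypChain (n + 1) - hypChain n) := by
      rw [h, sub_sub_cancel, ← mul_assoc, ← mul_assoc, ← map_mul, inv_mul_cancel₀ hc, map_one,
        one_mul]
    rw [this]
    exact (AbsSummableAt.C _).mul h0.le ((ih.2 ρ h0 h1).sub h0.le (ih.1 ρ h0 h1))

lemma constantCoeff_kSeries : constantCoeff kSeries = 1 := by
  rw [← coeff_zero_eq_constantCoeff_apply, kSeries, coeff_mk, binomHalf_zero, one_pow]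

lemma binomHalf_logConvex {i n : ℕ} (h : i ≤ n) :
    binomHalf (i + 1) * binomHalf n ≤ binomHalf (n + 1) * binomHalf i := by
  rw [binomHalf_succ_eq, binomHalf_succ_eq]
  have h1 : ((i : ℝ) + 1 / 2) / (i + 1) ≤ (n + 1 / 2) / (n + 1) := by
    rw [div_le_div_iff₀ (by positivity) (by positivity)]
    have : (i : ℝ) ≤ n := by exact_mod_cast h
    linarith
  have h2 := mul_pos (binomHalf_pos i) (binomHalf_pos n)
  nlinarith

lemma kSeries_inv_mul : kSeries⁻¹ * kSeries = 1 :=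
  PowerSeries.inv_mul_cancel _ (by simp [constantCoeff_kSeries])

lemma conv_kSeries_inv : ConvergesOnDisc kSeries⁻¹ := by
  refine ConvergesOnDisc.of_bounded (B := 1) fun n => ?_
  have hk : ∀ n, coeff n kSeries = binomHalf n ^ 2 := fun n => coeff_mk _ _
  rcases n with _ | n
  · simp [constantCoeff_kSeries]
  · have h := coeff_inverse_of_logConvex (a := kSeries) (w := kSeries⁻¹)
      (by simp [constantCoeff_kSeries])
      (fun n => by rw [hk]; exact pow_pos (binomHalf_pos n) 2)
      (fun i n hin => by
        rw [hk, hk, hk, hk, ← mul_pow, ← mul_pow]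
        exact pow_le_pow_left₀ (mul_pos (binomHalf_pos _) (binomHalf_pos _)).le
          (binomHalf_logConvex hin) 2)
      kSeries_inv_mul n
    rw [hk] at h
    have := pow_le_one₀ (n := 2) (binomHalf_pos (n + 1)).le (binomHalf_le_one (n + 1))
    exact abs_le.2 ⟨by linarith, by linarith⟩

/-- The Stieltjes chain attached to `K` and `E`, in the variable `k`. -/
lemma stieltjesChain_hypChain :
    StieltjesChain chainCoeff (fun n => expand 2 two_ne_zero (hypChain n))
      (expand 2 two_ne_zero kSeries⁻¹) where
  pos := chainCoeff_pos
  coeff_zero n := by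
    have := coeff_expand_mul 2 two_ne_zero (hypChain n) 0
    rw [mul_zero] at this
    rw [this, hypChain, coeff_mk, hypCoeff]
  rec_eq n := by
    conv_lhs => rw [hypChain_rec n]
    rw [map_sub, map_mul, map_mul, expand_C, expand_X]
  inv_mul := by rw [hypChain_zero, ← map_mul, kSeries_inv_mul, map_one]
  conv n := (conv_hypChain n).expand
  conv_inv := conv_kSeries_inv.expand

end Hypergeometric

open MeasureTheory
open scoped Real

section TrigIntegrals

lemma integral_div_sqrt_one_sub_sq (φ : ℝ → ℝ) :
    ∫ z in (0:ℝ)..1, φ z / √(1 - z ^ 2) = ∫ θ in (0:ℝ)..(π / 2), φ (Real.sin θ) := by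
  have hpi := Real.pi_pos
  have himg : Real.sin '' Set.Ioo 0 (π / 2) = Set.Ioo 0 1 := by
    ext z
    constructor
    · rintro ⟨θ, ⟨h0, h1⟩, rfl⟩
      refine ⟨Real.sin_pos_of_pos_of_lt_pi h0 (by linarith), ?_⟩
      rw [← Real.sin_pi_div_two]
      exact Real.sin_lt_sin_of_lt_of_le_pi_div_two (by linarith) le_rfl h1
    · rintro ⟨h0, h1⟩
      exact ⟨Real.arcsin z, ⟨Real.arcsin_pos.2 h0, Real.arcsin_lt_pi_div_two.2 h1⟩,
        Real.sin_arcsin (by linarith) h1.le⟩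
  rw [intervalIntegral.integral_of_le zero_le_one, intervalIntegral.integral_of_le (by linarith),
    integral_Ioc_eq_integral_Ioo, integral_Ioc_eq_integral_Ioo, ← himg,
    integral_image_eq_integral_abs_deriv_smul measurableSet_Ioo
      (fun θ _ => (Real.hasDerivAt_sin θ).hasDerivWithinAt)]
  · refine setIntegral_congr_fun measurableSet_Ioo fun θ hθ => ?_
    have hc : 0 < Real.cos θ := Real.cos_pos_of_mem_Ioo ⟨by linarith [hθ.1], hθ.2⟩
    simp only [smul_eq_mul]
    rw [show 1 - Real.sin θ ^ 2 = Real.cos θ ^ 2 by rw [Real.cos_sq'], Real.sqrt_sq hc.le,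
      abs_of_pos hc, mul_div_cancel₀ _ hc.ne']
  · exact fun a ha b hb hab => Real.injOn_sin ⟨by linarith [ha.1], ha.2.le⟩
      ⟨by linarith [hb.1], hb.2.le⟩ hab

lemma conv_invSqrt_one : ConvergesOnDisc (invSqrt 1) :=
  ConvergesOnDisc.of_bounded (B := 1) fun n => by
    rw [invSqrt, coeff_mk, one_pow, mul_one, abs_of_pos (binomHalf_pos n)]
    exact binomHalf_le_one n

lemma seriesSum_invSqrt_one_sq {u : ℝ} (hu : |u| < 1) :
    seriesSum (invSqrt 1) u ^ 2 * (1 - u) = 1 := by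
  have h := congrArg (fun f => seriesSum f u) (invSqrt_sq_mul 1)
  have hc := conv_invSqrt_one
  simp only [map_one, one_mul] at h
  rwa [(hc.mul hc).seriesSum_mul (ConvergesOnDisc.one.sub .X) hu, hc.seriesSum_mul hc hu,
    ConvergesOnDisc.one.seriesSum_sub .X hu, seriesSum_one, seriesSum_X, ← sq] at h

lemma seriesSum_invSqrt_one {u : ℝ} (hu : |u| < 1) :
    seriesSum (invSqrt 1) u = 1 / √(1 - u) := by
  have hpos : 0 < seriesSum (invSqrt 1) u := by
    by_contra! hneg
    have h0 : seriesSum (invSqrt 1) 0 = 1 := by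
      rw [seriesSum, tsum_eq_single 0 (fun n hn => by simp [hn])]
      simp [-coeff_zero_eq_constantCoeff, invSqrt,
        binomHalf_zero]
    have hle : ∀ x ∈ Set.uIcc u 0, |x| < 1 := fun x hx => by
      refine lt_of_le_of_lt ?_ hu
      simpa using Set.abs_sub_right_of_mem_uIcc hx
    have hcont : ContinuousOn (seriesSum (invSqrt 1)) (Set.uIcc u 0) := fun x hx =>
      (conv_invSqrt_one.analyticAt (hle x hx)).continuousAt.continuousWithinAt
    obtain ⟨x, hx, hx0⟩ := intermediate_value_uIcc hcont
      (Set.mem_uIcc.2 (Or.inl ⟨hneg, by rw [h0]; exact zero_le_one⟩))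
    have := seriesSum_invSqrt_one_sq (hle x hx)
    rw [hx0] at this
    simp at this
  have h1 : 0 < 1 - u := by linarith [(abs_lt.1 hu).2]
  have h2 := seriesSum_invSqrt_one_sq hu
  rw [eq_div_iff (Real.sqrt_pos.2 h1).ne']
  have h3 : (seriesSum (invSqrt 1) u * √(1 - u)) ^ 2 = 1 := by
    rw [mul_pow, Real.sq_sqrt h1.le, h2]
  have h4 := mul_pos hpos (Real.sqrt_pos.2 h1)
  nlinarith

lemma hasSum_binomHalf {u : ℝ} (hu : |u| < 1) :
    HasSum (fun n => binomHalf n * u ^ n) (1 / √(1 - u)) := by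
  have h := (conv_invSqrt_one.summable hu).hasSum
  change HasSum _ (seriesSum (invSqrt 1) u) at h
  rw [seriesSum_invSqrt_one hu] at h
  simpa [invSqrt] using h

lemma integral_sin_pow_eq_binomHalf (n : ℕ) :
    ∫ θ in (0:ℝ)..(π / 2), Real.sin θ ^ (2 * n) = π / 2 * binomHalf n := by
  induction n with
  | zero => simp [binomHalf_zero]
  | succ n ih =>
    rw [show 2 * (n + 1) = 2 * n + 2 by ring, integral_sin_pow, ih, binomHalf_succ_eq]
    simp
    field_simp

lemma abs_mul_sin_sq_lt {s : ℝ} (hs : |s| < 1) (θ : ℝ) : |s * Real.sin θ ^ 2| < 1 := by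
  rw [abs_mul, abs_of_nonneg (sq_nonneg (Real.sin θ))]
  exact (mul_le_of_le_one_right (abs_nonneg s) (Real.sin_sq_le_one θ)).trans_lt hs

lemma one_sub_mul_sin_sq_pos {s : ℝ} (hs : |s| < 1) (θ : ℝ) : 0 < 1 - s * Real.sin θ ^ 2 := by
  linarith [(abs_lt.1 (abs_mul_sin_sq_lt hs θ)).2]

lemma integral_sin_pow_mul_div_sqrt {s : ℝ} (hs : |s| < 1) (m : ℕ) :
    ∫ θ in (0:ℝ)..(π / 2), Real.sin θ ^ (2 * m) * (1 / √(1 - s * Real.sin θ ^ 2)) =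
      π / 2 * seriesSum (mk fun n => binomHalf n * binomHalf (n + m)) s := by
  have h := intervalIntegral.hasSum_integral_of_dominated_convergence (μ := volume)
    (a := 0) (b := π / 2)
    (F := fun (n : ℕ) θ => Real.sin θ ^ (2 * m) * (binomHalf n * (s * Real.sin θ ^ 2) ^ n))
    (f := fun θ => Real.sin θ ^ (2 * m) * (1 / √(1 - s * Real.sin θ ^ 2)))
    (fun n _ => |s| ^ n) (fun n => by fun_prop) (fun n => ae_of_all _ fun θ _ => ?_)
    (ae_of_all _ fun θ _ => summable_geometric_of_lt_one (abs_nonneg s) hs)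
    intervalIntegrable_const
    (ae_of_all _ fun θ _ => (hasSum_binomHalf (abs_mul_sin_sq_lt hs θ)).mul_left _)
  · rw [← h.tsum_eq, seriesSum, ← tsum_mul_left]
    refine tsum_congr fun n => ?_
    rw [coeff_mk]
    have : ∀ θ : ℝ, Real.sin θ ^ (2 * m) * (binomHalf n * (s * Real.sin θ ^ 2) ^ n) =
        binomHalf n * s ^ n * Real.sin θ ^ (2 * (n + m)) := fun θ => by
      rw [mul_pow, ← pow_mul, mul_add, pow_add]
      ring
    simp only [this]
    rw [intervalIntegral.integral_const_mul, integral_sin_pow_eq_binomHalf]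
    ring
  · rw [norm_mul, norm_mul, norm_pow, norm_pow, norm_mul, Real.norm_eq_abs, Real.norm_eq_abs,
      Real.norm_eq_abs, mul_pow, abs_of_pos (binomHalf_pos n)]
    have h1 : |Real.sin θ| ^ (2 * m) ≤ 1 := pow_le_one₀ (abs_nonneg _) (Real.abs_sin_le_one θ)
    have h2 : ‖Real.sin θ ^ 2‖ ^ n ≤ 1 := pow_le_one₀ (norm_nonneg _) (by
      rw [Real.norm_eq_abs, abs_of_nonneg (sq_nonneg _)]
      exact Real.sin_sq_le_one θ)
    have h3 := binomHalf_le_one n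
    have h4 := (binomHalf_pos n).le
    calc |Real.sin θ| ^ (2 * m) * (binomHalf n * (|s| ^ n * ‖Real.sin θ ^ 2‖ ^ n))
        ≤ 1 * (1 * (|s| ^ n * 1)) := by gcongr
      _ = |s| ^ n := by ring

lemma integral_one_div_sqrt {s : ℝ} (hs : |s| < 1) :
    ∫ θ in (0:ℝ)..(π / 2), 1 / √(1 - s * Real.sin θ ^ 2) = π / 2 * seriesSum kSeries s := by
  simpa [kSeries, sq] using integral_sin_pow_mul_div_sqrt hs 0

lemma integral_sin_sq_div_sqrt {s : ℝ} (hs : |s| < 1) :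
    ∫ θ in (0:ℝ)..(π / 2), Real.sin θ ^ 2 * (1 / √(1 - s * Real.sin θ ^ 2)) =
      π / 2 * seriesSum jSeries s := by
  simpa [jSeries] using integral_sin_pow_mul_div_sqrt hs 1

lemma continuous_one_div_sqrt {s : ℝ} (hs : |s| < 1) :
    Continuous fun θ : ℝ => 1 / √(1 - s * Real.sin θ ^ 2) :=
  Continuous.div continuous_const (by fun_prop) fun θ =>
    (Real.sqrt_pos.2 (one_sub_mul_sin_sq_pos hs θ)).ne'

lemma abs_sq_lt_one {k : ℝ} (hk : |k| < 1) : |k ^ 2| < 1 := by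
  rw [abs_pow]
  exact pow_lt_one₀ (abs_nonneg k) hk two_ne_zero

lemma Kc_eq {k : ℝ} (hk : |k| < 1) : Kc k = π / 2 * seriesSum kSeries (k ^ 2) := by
  rw [← integral_one_div_sqrt (abs_sq_lt_one hk),
    ← integral_div_sqrt_one_sub_sq fun z => 1 / √(1 - k ^ 2 * z ^ 2), Kc]
  refine intervalIntegral.integral_congr fun z hz => ?_
  rw [Set.uIcc_of_le zero_le_one] at hz
  have : 0 ≤ 1 - z ^ 2 := by nlinarith [hz.1, hz.2]
  simp only [Real.sqrt_mul this]
  rw [div_div, mul_comm]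

lemma Ec_eq {k : ℝ} (hk : |k| < 1) :
    Ec k = π / 2 * (seriesSum kSeries (k ^ 2) - k ^ 2 * seriesSum jSeries (k ^ 2)) := by
  have hs := abs_sq_lt_one hk
  have hc := continuous_one_div_sqrt hs
  rw [Ec, integral_div_sqrt_one_sub_sq fun z => √(1 - k ^ 2 * z ^ 2), mul_sub, mul_left_comm,
    ← integral_one_div_sqrt hs, ← integral_sin_sq_div_sqrt hs,
    ← intervalIntegral.integral_const_mul, ← intervalIntegral.integral_sub]
  · refine intervalIntegral.integral_congr fun θ _ => ?_
    have h := one_sub_mul_sin_sq_pos hs θ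
    have h1 := Real.sqrt_pos.2 h
    have h2 := Real.sq_sqrt h.le
    field_simp
    linear_combination h2
  · exact hc.intervalIntegrable _ _
  · exact Continuous.intervalIntegrable (by fun_prop) _ _

lemma Pic_eq {k : ℝ} :
    Pic (2 * k ^ 2 / (1 + k ^ 2)) k = (1 + k ^ 2) * ∫ θ in (0:ℝ)..(π / 2),
      1 / ((1 + k ^ 2 - 2 * k ^ 2 * Real.sin θ ^ 2) * √(1 - k ^ 2 * Real.sin θ ^ 2)) := by
  rw [← integral_div_sqrt_one_sub_sq fun z =>
    1 / ((1 + k ^ 2 - 2 * k ^ 2 * z ^ 2) * √(1 - k ^ 2 * z ^ 2)), Pic,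
    ← intervalIntegral.integral_const_mul]
  refine intervalIntegral.integral_congr fun z hz => ?_
  rw [Set.uIcc_of_le zero_le_one] at hz
  have : 0 ≤ 1 - z ^ 2 := by nlinarith [hz.1, hz.2]
  have h1 : 0 < 1 + k ^ 2 := by positivity
  simp only [Real.sqrt_mul this]
  rw [show 1 - 2 * k ^ 2 / (1 + k ^ 2) * z ^ 2 =
    (1 + k ^ 2 - 2 * k ^ 2 * z ^ 2) / (1 + k ^ 2) by field_simp]
  simp only [mul_inv, div_eq_mul_inv, inv_inv]
  ring

end TrigIntegrals

section ThirdKind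

/-- The integrand of the complete elliptic integral of the third kind with parameter
`2 s / (1 + s)` at modulus `√s`, divided by `1 + s`. -/
noncomputable def piIntegrand (s θ : ℝ) : ℝ :=
  1 / ((1 + s - 2 * s * Real.sin θ ^ 2) * √(1 - s * Real.sin θ ^ 2))

/-- The derivative of `piIntegrand` with respect to the parameter. -/
noncomputable def piIntegrandDeriv (s θ : ℝ) : ℝ :=
  -(1 - 2 * Real.sin θ ^ 2) /
      ((1 + s - 2 * s * Real.sin θ ^ 2) ^ 2 * √(1 - s * Real.sin θ ^ 2)) +
    Real.sin θ ^ 2 /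
      (2 * (1 + s - 2 * s * Real.sin θ ^ 2) * √(1 - s * Real.sin θ ^ 2) ^ 3)

lemma one_add_sub_two_mul_sin_sq_pos {s : ℝ} (hs : |s| < 1) (θ : ℝ) :
    0 < 1 + s - 2 * s * Real.sin θ ^ 2 := by
  have h1 := Real.sin_sq_add_cos_sq θ
  obtain ⟨h2, h3⟩ := abs_lt.1 hs
  have h4 : 1 + s - 2 * s * Real.sin θ ^ 2 =
      (1 - s) * Real.sin θ ^ 2 + (1 + s) * Real.cos θ ^ 2 := by linear_combination (-1 - s) * h1
  rw [h4]
  rcases (sq_nonneg (Real.sin θ)).eq_or_lt with h | h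
  · nlinarith
  · nlinarith [mul_pos (sub_pos.2 h3) h, mul_nonneg (by linarith : 0 ≤ 1 + s)
      (sq_nonneg (Real.cos θ))]

lemma hasDerivAt_piIntegrand {s : ℝ} (hs : |s| < 1) (θ : ℝ) :
    HasDerivAt (fun s => piIntegrand s θ) (piIntegrandDeriv s θ) s := by
  have hN := one_add_sub_two_mul_sin_sq_pos hs θ
  have hD := one_sub_mul_sin_sq_pos hs θ
  have hq := Real.sqrt_pos.2 hD
  have d1 : HasDerivAt (fun s : ℝ => 1 + s - 2 * s * Real.sin θ ^ 2)
      (1 - 2 * Real.sin θ ^ 2) s := by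
    simpa [Pi.sub_def] using ((hasDerivAt_id s).const_add 1).sub
      (((hasDerivAt_id s).const_mul 2).mul_const (Real.sin θ ^ 2))
  have d2 : HasDerivAt (fun s : ℝ => 1 - s * Real.sin θ ^ 2) (-Real.sin θ ^ 2) s := by
    simpa using ((hasDerivAt_id s).mul_const (Real.sin θ ^ 2)).const_sub 1
  have d3 := (d1.mul (d2.sqrt hD.ne')).inv (mul_pos hN hq).ne'
  simp only [piIntegrand, one_div]
  refine d3.congr_deriv ?_
  simp only [piIntegrandDeriv, Pi.mul_apply]
  field_simp
  ring

lemma continuousOn_piIntegrandDeriv :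
    ContinuousOn (fun x : ℝ × ℝ => piIntegrandDeriv x.1 x.2) {x | |x.1| < 1} := by
  unfold piIntegrandDeriv
  refine ContinuousOn.add (ContinuousOn.div (by fun_prop) (by fun_prop) fun x hx => ?_)
    (ContinuousOn.div (by fun_prop) (by fun_prop) fun x hx => ?_)
  all_goals
    have h1 := one_add_sub_two_mul_sin_sq_pos hx x.2
    have h2 := Real.sqrt_pos.2 (one_sub_mul_sin_sq_pos hx x.2)
    positivity

lemma continuous_piIntegrand {s : ℝ} (hs : |s| < 1) : Continuous (piIntegrand s) := by
  unfold piIntegrand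
  refine Continuous.div continuous_const (by fun_prop) fun θ => ?_
  exact (mul_pos (one_add_sub_two_mul_sin_sq_pos hs θ)
    (Real.sqrt_pos.2 (one_sub_mul_sin_sq_pos hs θ))).ne'

lemma hasDerivAt_integral_piIntegrand {s : ℝ} (hs : |s| < 1) :
    IntervalIntegrable (piIntegrandDeriv s) volume 0 (π / 2) ∧
    HasDerivAt (fun s => ∫ θ in (0:ℝ)..(π / 2), piIntegrand s θ)
      (∫ θ in (0:ℝ)..(π / 2), piIntegrandDeriv s θ) s := by
  obtain ⟨ρ, h1, h2⟩ := exists_between hs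
  have hnhds : Set.Icc (-ρ) ρ ∈ 𝓝 s := Icc_mem_nhds (abs_lt.1 h1).1 (abs_lt.1 h1).2
  have hlt : ∀ x ∈ Set.Icc (-ρ) ρ, |x| < 1 := fun x hx => (abs_le.2 hx).trans_lt h2
  obtain ⟨M, hM⟩ := (isCompact_Icc (a := -ρ) (b := ρ)).prod
    (isCompact_uIcc (a := 0) (b := π / 2)) |>.exists_bound_of_continuousOn
    (continuousOn_piIntegrandDeriv.mono fun x hx => hlt x.1 hx.1)
  have hc : Continuous (piIntegrandDeriv s) := by
    refine continuousOn_univ.1 ?_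
    exact continuousOn_piIntegrandDeriv.comp (f := fun θ => (s, θ))
      (by fun_prop) fun θ _ => hs
  refine intervalIntegral.hasDerivAt_integral_of_dominated_loc_of_deriv_le
    (bound := fun _ => M) hnhds ?_ ((continuous_piIntegrand hs).intervalIntegrable _ _)
    hc.aestronglyMeasurable ?_ intervalIntegrable_const ?_
  · filter_upwards [hnhds] with x hx
    exact (continuous_piIntegrand (hlt x hx)).aestronglyMeasurable
  · exact ae_of_all _ fun θ hθ x hx => hM (x, θ) ⟨hx, Set.uIoc_subset_uIcc hθ⟩
  · exact ae_of_all _ fun θ _ x hx => hasDerivAt_piIntegrand (hlt x hx) θ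

/-- The trigonometric primitive behind the differential equation of the third-kind integral. -/
lemma hasDerivAt_sin_mul_cos_mul_piIntegrand {s : ℝ} (hs : |s| < 1) (θ : ℝ) :
    HasDerivAt (fun θ => -(Real.sin θ * Real.cos θ) *
        (piIntegrand s θ + 1 / 2 * (1 / √(1 - s * Real.sin θ ^ 2))))
      ((-(2 * s) - (1 - s) / 2) * piIntegrand s θ + (1 - s ^ 2) * piIntegrandDeriv s θ +
        1 / 2 * (Real.sin θ ^ 2 * (1 / √(1 - s * Real.sin θ ^ 2)))) θ := by
  have hN := one_add_sub_two_mul_sin_sq_pos hs θ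
  have hD := one_sub_mul_sin_sq_pos hs θ
  have hq := Real.sqrt_pos.2 hD
  have hsq := Real.sq_sqrt hD.le
  have d0 : HasDerivAt (fun θ => Real.sin θ ^ 2) (2 * Real.sin θ * Real.cos θ) θ := by
    simpa using (Real.hasDerivAt_sin θ).fun_pow 2
  have d1 : HasDerivAt (fun θ : ℝ => 1 + s - 2 * s * Real.sin θ ^ 2)
      (-(2 * s * (2 * Real.sin θ * Real.cos θ))) θ := (d0.const_mul (2 * s)).const_sub (1 + s)
  have d2 : HasDerivAt (fun θ : ℝ => 1 - s * Real.sin θ ^ 2)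
      (-(s * (2 * Real.sin θ * Real.cos θ))) θ := (d0.const_mul s).const_sub 1
  have d3 := (d1.mul (d2.sqrt hD.ne')).inv (mul_pos hN hq).ne'
  have d4 := ((d2.sqrt hD.ne').inv hq.ne').const_mul (1 / 2)
  have d5 := (((Real.hasDerivAt_sin θ).mul (Real.hasDerivAt_cos θ)).neg).mul (d3.add d4)
  simp only [piIntegrand, one_div] at d5 ⊢
  refine d5.congr_deriv ?_
  simp only [piIntegrandDeriv, Pi.mul_apply, Pi.neg_apply, Pi.add_apply, Pi.inv_apply]
  have hc : Real.cos θ ^ 2 = 1 - Real.sin θ ^ 2 := Real.cos_sq' θ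
  generalize Real.cos θ = c at *
  generalize Real.sin θ = t at *
  generalize √(1 - s * t ^ 2) = w at *
  clear d0 d1 d2 d3 d4 d5
  generalize hNd : 1 + s - 2 * s * t ^ 2 = N at *
  field_simp
  simp only [hsq, hc]
  rw [← hNd]
  ring

lemma integral_piIntegrand_ode {s : ℝ} (hs : |s| < 1) :
    (-(2 * s) - (1 - s) / 2) * (∫ θ in (0:ℝ)..(π / 2), piIntegrand s θ) +
        (1 - s ^ 2) * (∫ θ in (0:ℝ)..(π / 2), piIntegrandDeriv s θ) =
      -(π / 4 * seriesSum jSeries s) := by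
  have i1 := (continuous_piIntegrand hs).intervalIntegrable (μ := volume) 0 (π / 2)
  have i2 := (hasDerivAt_integral_piIntegrand hs).1
  have i3 : IntervalIntegrable (fun θ => Real.sin θ ^ 2 * (1 / √(1 - s * Real.sin θ ^ 2)))
      volume 0 (π / 2) :=
    ((by fun_prop : Continuous fun θ => Real.sin θ ^ 2).mul
      (continuous_one_div_sqrt hs)).intervalIntegrable _ _
  have h := intervalIntegral.integral_eq_sub_of_hasDerivAt
    (fun θ (_ : θ ∈ Set.uIcc 0 (π / 2)) => hasDerivAt_sin_mul_cos_mul_piIntegrand hs θ)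
    (((i1.const_mul _).add (i2.const_mul _)).add (i3.const_mul _))
  rw [intervalIntegral.integral_add ((i1.const_mul _).add (i2.const_mul _)) (i3.const_mul _),
    intervalIntegral.integral_add (i1.const_mul _) (i2.const_mul _),
    intervalIntegral.integral_const_mul, intervalIntegral.integral_const_mul,
    intervalIntegral.integral_const_mul, integral_sin_sq_div_sqrt hs] at h
  simp only [Real.cos_pi_div_two, Real.sin_zero, mul_zero, zero_mul, neg_zero, sub_zero] at h
  linear_combination h

lemma conv_invSqrt_neg_one : ConvergesOnDisc (invSqrt (-1)) :=
  ConvergesOnDisc.of_bounded (B := 1) fun n => by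
    rw [invSqrt, coeff_mk, abs_mul, abs_pow, abs_neg, abs_one, one_pow, mul_one,
      abs_of_pos (binomHalf_pos n)]
    exact binomHalf_le_one n

lemma seriesSum_invSqrt_neg_one_sq {s : ℝ} (hs : |s| < 1) :
    seriesSum (invSqrt (-1)) s ^ 2 * (1 + s) = 1 := by
  have h := congrArg (fun f => seriesSum f s) (invSqrt_sq_mul (-1))
  have hc := conv_invSqrt_neg_one
  rw [show (1 - C (-1) * X : ℝ⟦X⟧) = 1 + X by simp] at h
  rwa [(hc.mul hc).seriesSum_mul (ConvergesOnDisc.one.add .X) hs, hc.seriesSum_mul hc hs,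
    ConvergesOnDisc.one.seriesSum_add .X hs, seriesSum_one, seriesSum_X, ← sq] at h

lemma seriesSum_derivative_invSqrt_neg_one {s : ℝ} (hs : |s| < 1) :
    (1 + s) * seriesSum (d⁄dX ℝ (invSqrt (-1))) s = -(1 / 2) * seriesSum (invSqrt (-1)) s := by
  have h := congrArg (fun f => seriesSum f s) (one_sub_mul_derivative_invSqrt (-1))
  have hc := conv_invSqrt_neg_one
  rw [show (1 - C (-1) * X : ℝ⟦X⟧) = 1 + X by simp] at h
  rw [(ConvergesOnDisc.one.add .X).seriesSum_mul hc.derivative hs,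
    ConvergesOnDisc.one.seriesSum_add .X hs, seriesSum_one, seriesSum_X,
    (ConvergesOnDisc.C _).seriesSum_mul hc hs, seriesSum_C] at h
  linear_combination h

lemma ConvergesOnDisc.exists_antiderivative {h : ℝ⟦X⟧} (hh : ConvergesOnDisc h) :
    ∃ f, ConvergesOnDisc f ∧ d⁄dX ℝ f = h := by
  refine ⟨mk fun n => coeff n (PowerSeries.X * h) / n, fun ρ h0 h1 => ?_, ?_⟩
  · refine Summable.of_nonneg_of_le (fun n => by positivity) (fun n => ?_)
      (ConvergesOnDisc.X.mul hh ρ h0 h1)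
    rw [coeff_mk]
    refine mul_le_mul_of_nonneg_right ?_ (by positivity)
    rcases n.eq_zero_or_pos with rfl | hn
    · simp
    · rw [abs_div, Nat.abs_cast]
      exact div_le_self (abs_nonneg _) (by exact_mod_cast hn)
  · ext n
    rw [coeff_derivative, coeff_mk, coeff_succ_X_mul]
    push_cast
    field_simp

/-- After multiplication by an explicit factor, the third-kind integral is the sum of a power
series with an explicit derivative. -/
lemma exists_piSeries : ∃ φ : ℝ⟦X⟧, ConvergesOnDisc φ ∧
    d⁄dX ℝ φ = C (-(π / 4)) * (invSqrt (-1) * jSeries) ∧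
    ∀ s, |s| < 1 → (1 - s ^ 2) * seriesSum (invSqrt (-1)) s *
      (∫ θ in (0:ℝ)..(π / 2), piIntegrand s θ) = seriesSum φ s := by
  have hy := conv_invSqrt_neg_one
  have hyj := hy.mul conv_jSeries
  obtain ⟨φ, hφ, hφ'⟩ := ((ConvergesOnDisc.C (-(π / 4))).mul hyj).exists_antiderivative
  set f : ℝ → ℝ := fun s => (1 - s ^ 2) * seriesSum (invSqrt (-1)) s *
      (∫ θ in (0:ℝ)..(π / 2), piIntegrand s θ) with hf
  have hd : ∀ s, |s| < 1 → HasDerivAt (fun s => f s - seriesSum φ s) 0 s := fun s hs => by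
    have hs1 : 1 + s ≠ 0 := by linarith [(abs_lt.1 hs).1]
    have d1 : HasDerivAt (fun s : ℝ => 1 - s ^ 2) (-(2 * s)) s := by
      simpa using ((hasDerivAt_id s).fun_pow 2).const_sub 1
    have d2 := ((d1.fun_mul (hy.hasDerivAt hs)).fun_mul
      (hasDerivAt_integral_piIntegrand hs).2).fun_sub (hφ.hasDerivAt hs)
    refine d2.congr_deriv ?_
    have h1 := integral_piIntegrand_ode hs
    have h2 := seriesSum_derivative_invSqrt_neg_one hs
    rw [hφ', (ConvergesOnDisc.C _).seriesSum_mul hyj hs, seriesSum_C,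
      hy.seriesSum_mul conv_jSeries hs]
    linear_combination seriesSum (invSqrt (-1)) s * h1 +
      (1 - s) * (∫ θ in (0:ℝ)..(π / 2), piIntegrand s θ) * h2
  have hconst : ∀ s, |s| < 1 → f s - seriesSum φ s = f 0 - seriesSum φ 0 := fun s hs => by
    have hmem : ∀ x, x ∈ Set.Ioo (-1 : ℝ) 1 ↔ |x| < 1 := fun x => abs_lt.symm
    refine isOpen_Ioo.is_const_of_deriv_eq_zero (s := Set.Ioo (-1 : ℝ) 1) isPreconnected_Ioo
      (fun x hx => (hd x ((hmem x).1 hx)).differentiableAt.differentiableWithinAt)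
      (fun x hx => (hd x ((hmem x).1 hx)).deriv) ((hmem s).2 hs) ((hmem 0).2 (by simp))
  refine ⟨φ + C (f 0 - seriesSum φ 0), hφ.add (.C _), ?_, fun s hs => ?_⟩
  · rw [map_add, hφ', derivative_C, add_zero]
  · rw [hφ.seriesSum_add (.C _) hs, seriesSum_C, ← hconst s hs]
    ring

end ThirdKind

section Wronskian

/-- The Wronskian of a polynomial and a function. -/
noncomputable def polyWronskian (r : Polynomial ℝ) (f : ℝ → ℝ) (x : ℝ) : ℝ :=
  r.eval x * deriv f x - r.derivative.eval x * f x

lemma Polynomial.analyticAt_eval (p : Polynomial ℝ) (x : ℝ) :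
    AnalyticAt ℝ (fun y => p.eval y) x := by
  simpa using (analyticAt_id (𝕜 := ℝ) (z := x)).aeval_polynomial p

lemma le_analyticOrderAt_mul_left {f g : ℝ → ℝ} {x : ℝ} (hf : AnalyticAt ℝ f x)
    (hg : AnalyticAt ℝ g x) : analyticOrderAt g x ≤ analyticOrderAt (fun y => f y * g y) x := by
  rw [show (fun y => f y * g y) = f * g from rfl, analyticOrderAt_mul hf hg]
  exact le_add_self

lemma natCast_sub_one_le_analyticOrderAt_deriv {f : ℝ → ℝ} {x : ℝ} (hf : AnalyticAt ℝ f x)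
    {m : ℕ} (hm : 1 ≤ m) (h : (m : ℕ∞) ≤ analyticOrderAt f x) :
    ((m - 1 : ℕ) : ℕ∞) ≤ analyticOrderAt (deriv f) x := by
  obtain ⟨n, rfl⟩ := Nat.exists_eq_add_of_le' hm
  have h0 : f x = 0 := by
    refine hf.analyticOrderAt_ne_zero.1 fun h0 => ?_
    rw [h0] at h
    simp at h
  rw [Nat.add_sub_cancel, analyticOrderAt_deriv_ge_iff hf h0]
  exact_mod_cast h

variable {r : Polynomial ℝ} {f : ℝ → ℝ}

lemma analyticAt_polyWronskian {x : ℝ} (hf : AnalyticAt ℝ f x) :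
    AnalyticAt ℝ (polyWronskian r f) x :=
  ((r.analyticAt_eval x).mul hf.deriv).sub ((r.derivative.analyticAt_eval x).mul hf)

lemma le_analyticOrderAt_polyWronskian {x : ℝ} (hf : AnalyticAt ℝ f x) {m : ℕ} (hm : 1 ≤ m)
    (h : (m : ℕ∞) ≤ analyticOrderAt f x) :
    (((if r.IsRoot x then m else m - 1 : ℕ) : ℕ∞)) ≤ analyticOrderAt (polyWronskian r f) x := by
  have hd := natCast_sub_one_le_analyticOrderAt_deriv hf hm h
  have hr := r.analyticAt_eval x
  have h2 := h.trans (le_analyticOrderAt_mul_left (r.derivative.analyticAt_eval x) hf)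
  refine le_trans ?_ (le_analyticOrderAt_sub (f := fun y => r.eval y * deriv f y)
    (g := fun y => r.derivative.eval y * f y))
  split_ifs with hroot
  · refine le_min ?_ h2
    rw [show (fun y => r.eval y * deriv f y) = (fun y => r.eval y) * deriv f from rfl,
      analyticOrderAt_mul hr hf.deriv]
    have h1 : (1 : ℕ∞) ≤ analyticOrderAt (fun y => r.eval y) x :=
      Order.one_le_iff_ne_zero.2 (hr.analyticOrderAt_ne_zero.2 hroot)
    calc (m : ℕ∞) = 1 + ((m - 1 : ℕ) : ℕ∞) := by
          rw [← Nat.cast_one, ← Nat.cast_add, Nat.add_sub_cancel' hm]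
      _ ≤ _ := add_le_add h1 hd
  · exact le_min (hd.trans (le_analyticOrderAt_mul_left hr hf.deriv))
      (le_trans (by exact_mod_cast Nat.sub_le m 1) h2)

lemma hasDerivAt_div_polynomial {x : ℝ} (hf : AnalyticAt ℝ f x) (hx : r.eval x ≠ 0) :
    HasDerivAt (fun y => f y / r.eval y) (polyWronskian r f x / r.eval x ^ 2) x := by
  refine (hf.differentiableAt.hasDerivAt.fun_div (r.hasDerivAt x) hx).congr_deriv ?_
  rw [polyWronskian]
  ring

/-- Rolle's theorem for the quotient `f / r` between two zeros of `f`. -/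
lemma exists_polyWronskian_eq_zero {a b : ℝ} (hab : a < b)
    (hf : ∀ x ∈ Set.Icc a b, AnalyticAt ℝ f x) (hr : ∀ x ∈ Set.Icc a b, r.eval x ≠ 0)
    (ha : f a = 0) (hb : f b = 0) : ∃ z ∈ Set.Ioo a b, polyWronskian r f z = 0 := by
  have hd := fun x hx => hasDerivAt_div_polynomial (hf x hx) (hr x hx)
  obtain ⟨z, hz, h⟩ := exists_hasDerivAt_eq_zero hab
    (fun x hx => (hd x hx).continuousAt.continuousWithinAt) (by simp [ha, hb])
    (fun x hx => hd x (Set.Ioo_subset_Icc_self hx))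
  refine ⟨z, hz, ?_⟩
  rcases div_eq_zero_iff.1 h with h | h
  · exact h
  · exact absurd (pow_eq_zero_iff two_ne_zero |>.1 h) (hr z (Set.Ioo_subset_Icc_self hz))

/-- Passing to the Wronskian with a nonzero polynomial `r` loses at most `deg r + 1` zeros. -/
lemma exists_order_polyWronskian (hr : r ≠ 0) (hf : ∀ x, |x| < 1 → AnalyticAt ℝ f x)
    {T : Finset ℝ} (hT : ∀ x ∈ T, |x| < 1) {m : ℝ → ℕ} (hm1 : ∀ x ∈ T, 1 ≤ m x)
    (hm : ∀ x ∈ T, (m x : ℕ∞) ≤ analyticOrderAt f x) :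
    ∃ (T' : Finset ℝ) (m' : ℝ → ℕ), (∀ x ∈ T', |x| < 1) ∧
      (∀ x ∈ T', (m' x : ℕ∞) ≤ analyticOrderAt (polyWronskian r f) x) ∧
      ∑ x ∈ T, m x ≤ ∑ x ∈ T', m' x + (r.natDegree + 1) := by
  classical
  have hzero : ∀ x ∈ T, f x = 0 := fun x hx => by
    refine (hf x (hT x hx)).analyticOrderAt_ne_zero.1 fun h0 => ?_
    have h1 := hm1 x hx
    have h2 := hm x hx
    rw [h0] at h2
    simp only [nonpos_iff_eq_zero, Nat.cast_eq_zero] at h2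
    omega
  set S := T.filter fun x => ¬ r.IsRoot x with hS
  have key : ∀ a b : ℝ, ∃ z, a ∈ S → b ∈ S → a < b → (∀ x ∈ Set.Icc a b, ¬ r.IsRoot x) →
      z ∈ Set.Ioo a b ∧ polyWronskian r f z = 0 := fun a b => by
    by_cases h : a ∈ S ∧ b ∈ S ∧ a < b ∧ ∀ x ∈ Set.Icc a b, ¬ r.IsRoot x
    · obtain ⟨ha, hb, hab, hroot⟩ := h
      have ha' := (Finset.mem_filter.1 ha).1
      have hb' := (Finset.mem_filter.1 hb).1
      obtain ⟨z, hz⟩ := exists_polyWronskian_eq_zero hab (fun x hx => hf x (abs_lt.2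
        ⟨(abs_lt.1 (hT a ha')).1.trans_le hx.1, hx.2.trans_lt (abs_lt.1 (hT b hb')).2⟩))
        hroot (hzero a ha') (hzero b hb')
      exact ⟨z, fun _ _ _ _ => hz⟩
    · exact ⟨0, fun h1 h2 h3 h4 => absurd ⟨h1, h2, h3, h4⟩ h⟩
  choose z hz using key
  set Z := ((S ×ˢ S).filter fun p => p.1 < p.2 ∧ ∀ x ∈ Set.Icc p.1 p.2, ¬ r.IsRoot x).image
    fun p => z p.1 p.2 with hZ
  have hZprop : ∀ y ∈ Z, |y| < 1 ∧ polyWronskian r f y = 0 ∧ ¬ r.IsRoot y := fun y hy => by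
    obtain ⟨⟨a, b⟩, hp, rfl⟩ := Finset.mem_image.1 hy
    obtain ⟨hp1, hab, hroot⟩ := Finset.mem_filter.1 hp
    obtain ⟨ha, hb⟩ := Finset.mem_product.1 hp1
    obtain ⟨h1, h2⟩ := hz a b ha hb hab hroot
    exact ⟨abs_lt.2 ⟨(abs_lt.1 (hT a (Finset.mem_filter.1 ha).1)).1.trans h1.1,
      h1.2.trans (abs_lt.1 (hT b (Finset.mem_filter.1 hb).1)).2⟩, h2,
      hroot _ (Set.Ioo_subset_Icc_self h1)⟩
  have hcard : S.card ≤ ((r.roots.toFinset ∪ Z) \ S).card + 1 := by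
    refine Finset.card_le_sdiff_of_interleaved fun a ha b hb hab _ => ?_
    by_cases hroot : ∀ x ∈ Set.Icc a b, ¬ r.IsRoot x
    · refine ⟨z a b, Finset.mem_union_right _ (Finset.mem_image.2 ⟨(a, b), ?_, rfl⟩),
        (hz a b ha hb hab hroot).1⟩
      exact Finset.mem_filter.2 ⟨Finset.mem_product.2 ⟨ha, hb⟩, hab, hroot⟩
    · push Not at hroot
      obtain ⟨x, hx, hxr⟩ := hroot
      refine ⟨x, Finset.mem_union_left _ (by simpa [hr] using hxr), ?_, ?_⟩
      · refine lt_of_le_of_ne hx.1 ?_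
        rintro rfl
        exact (Finset.mem_filter.1 ha).2 hxr
      · refine lt_of_le_of_ne hx.2 ?_
        rintro rfl
        exact (Finset.mem_filter.1 hb).2 hxr
  have hdiff : Z \ S = Z \ T := by
    ext y
    simp only [Finset.mem_sdiff, hS, Finset.mem_filter]
    exact ⟨fun h => ⟨h.1, fun hy => h.2 ⟨hy, (hZprop y h.1).2.2⟩⟩,
      fun h => ⟨h.1, fun hy => h.2 hy.1⟩⟩
  have hcard' : S.card ≤ r.natDegree + (Z \ T).card + 1 := by
    have h1 : ((r.roots.toFinset ∪ Z) \ S).card ≤ r.roots.toFinset.card + (Z \ S).card := by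
      rw [Finset.union_sdiff_distrib]
      exact (Finset.card_union_le _ _).trans
        (Nat.add_le_add_right (Finset.card_le_card Finset.sdiff_subset) _)
    have h2 := (Multiset.toFinset_card_le r.roots).trans r.card_roots'
    rw [hdiff] at h1
    omega
  refine ⟨T ∪ (Z \ T), fun x => if x ∈ T then (if r.IsRoot x then m x else m x - 1) else 1,
    fun x hx => ?_, fun x hx => ?_, ?_⟩
  · rcases Finset.mem_union.1 hx with h | h
    · exact hT x h
    · exact (hZprop x (Finset.mem_sdiff.1 h).1).1
  · rcases Finset.mem_union.1 hx with h | h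
    · simp only [h, if_true]
      exact le_analyticOrderAt_polyWronskian (hf x (hT x h)) (hm1 x h) (hm x h)
    · obtain ⟨h1, h2⟩ := Finset.mem_sdiff.1 h
      obtain ⟨h3, h4, -⟩ := hZprop x h1
      simp only [h2, if_false, Nat.cast_one]
      exact Order.one_le_iff_ne_zero.2
        ((analyticAt_polyWronskian (hf x h3)).analyticOrderAt_ne_zero.2 h4)
  · rw [Finset.sum_union Finset.disjoint_sdiff]
    have h1 : ∑ x ∈ Z \ T, (if x ∈ T then (if r.IsRoot x then m x else m x - 1) else 1) =
        (Z \ T).card := by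
      rw [Finset.card_eq_sum_ones]
      exact Finset.sum_congr rfl fun x hx => if_neg (Finset.mem_sdiff.1 hx).2
    have h2 : ∑ x ∈ T, m x ≤
        ∑ x ∈ T, (if x ∈ T then (if r.IsRoot x then m x else m x - 1) else 1) + S.card := by
      rw [hS, Finset.card_filter, ← Finset.sum_add_distrib]
      refine Finset.sum_le_sum fun x hx => ?_
      rw [if_pos hx]
      split_ifs <;> omega
    rw [h1]
    omega

/-- If the Wronskian with `r` vanishes on the unit interval, then `f` is a multiple of `r`. -/
lemma exists_eq_mul_of_polyWronskian_eq_zero (hr : r ≠ 0)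
    (hf : ∀ x, |x| < 1 → AnalyticAt ℝ f x) (hW : ∀ x, |x| < 1 → polyWronskian r f x = 0) :
    ∃ c : ℝ, ∀ x, |x| < 1 → f x = c * r.eval x := by
  obtain ⟨x₀, hx₀, hne⟩ : ∃ x ∈ Set.Ioo (-1 : ℝ) 1, r.eval x ≠ 0 := by
    by_contra! h
    exact hr (Polynomial.eq_zero_of_infinite_isRoot r
      ((Set.Ioo_infinite (by norm_num)).mono fun x hx => h x hx))
  have hnhds : ∀ᶠ x in 𝓝 x₀, x ∈ Set.Ioo (-1 : ℝ) 1 ∧ r.eval x ≠ 0 :=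
    (isOpen_Ioo.eventually_mem hx₀).and (r.continuous.continuousAt.eventually_ne hne)
  obtain ⟨ε, hε, hball⟩ := Metric.eventually_nhds_iff_ball.1 hnhds
  refine ⟨f x₀ / r.eval x₀, fun x hx => ?_⟩
  refine AnalyticOnNhd.eqOn_of_preconnected_of_eventuallyEq (U := Set.Ioo (-1 : ℝ) 1)
    (g := fun x => f x₀ / r.eval x₀ * r.eval x) (fun y hy => hf y (abs_lt.2 hy))
    (fun y _ => analyticAt_const.mul (r.analyticAt_eval y)) isPreconnected_Ioo hx₀ ?_
    (abs_lt.1 hx)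
  filter_upwards [Metric.ball_mem_nhds x₀ hε] with y hy
  have hd := fun x hx => hasDerivAt_div_polynomial (hf x (abs_lt.2 (hball x hx).1)) (hball x hx).2
  have := Metric.isOpen_ball.is_const_of_deriv_eq_zero (convex_ball x₀ ε).isPreconnected
    (fun x hx => (hd x hx).differentiableAt.differentiableWithinAt)
    (fun x hx => by rw [(hd x hx).deriv, hW x (abs_lt.2 (hball x hx).1), zero_div]; rfl)
    hy (Metric.mem_ball_self hε)
  rw [← this, div_mul_cancel₀ _ (hball y hy).2]

end Wronskian

section ZeroCount

/-- The power series of `2 / π` times the complete elliptic integral of the second kind in the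
squared modulus. -/
noncomputable def eSeries : ℝ⟦X⟧ := kSeries - X * jSeries

lemma conv_eSeries : ConvergesOnDisc eSeries :=
  conv_kSeries.sub (ConvergesOnDisc.X.mul conv_jSeries)

lemma seriesSum_eSeries {s : ℝ} (hs : |s| < 1) :
    seriesSum eSeries s = seriesSum kSeries s - s * seriesSum jSeries s := by
  rw [eSeries, conv_kSeries.seriesSum_sub (ConvergesOnDisc.X.mul conv_jSeries) hs,
    ConvergesOnDisc.X.seriesSum_mul conv_jSeries hs, seriesSum_X]

lemma derivative_kSeries : C 2 * ((1 - X) * d⁄dX ℝ kSeries) = kSeries - jSeries := by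
  ext n
  rw [coeff_C_mul, sub_mul, one_mul, map_sub, map_sub, coeff_derivative, kSeries, jSeries,
    coeff_mk, coeff_mk, coeff_mk]
  cases n with
  | zero =>
    have h := binomHalf_succ 0
    simp only [coeff_zero_X_mul, Nat.cast_zero, zero_add, binomHalf_zero] at h ⊢
    rw [show binomHalf 1 = 1 / 2 by linarith]
    norm_num
  | succ n =>
    have h := binomHalf_succ (n + 1)
    rw [coeff_succ_X_mul, coeff_derivative, coeff_mk]
    push_cast at h ⊢
    linear_combination (2 * binomHalf (n + 1 + 1) + 2 * binomHalf (n + 1)) * h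

lemma derivative_eSeries : d⁄dX ℝ eSeries = C (-(1 / 2)) * jSeries := by
  ext n
  have h := binomHalf_succ n
  rw [coeff_C_mul, coeff_derivative, eSeries, map_sub, coeff_succ_X_mul, kSeries, jSeries,
    coeff_mk, coeff_mk]
  linear_combination binomHalf (n + 1) * h

lemma hasDerivAt_seriesSum_sq {f : ℝ⟦X⟧} (hf : ConvergesOnDisc f) {k : ℝ} (hk : |k| < 1) :
    HasDerivAt (fun k => seriesSum f (k ^ 2)) (2 * k * seriesSum (d⁄dX ℝ f) (k ^ 2)) k := by
  have h := (hf.hasDerivAt (abs_sq_lt_one hk)).comp (h := fun k => k ^ 2) k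
    ((hasDerivAt_id' k).fun_pow 2)
  refine h.congr_deriv ?_
  push_cast
  ring

lemma analyticAt_seriesSum_sq {f : ℝ⟦X⟧} (hf : ConvergesOnDisc f) {k : ℝ} (hk : |k| < 1) :
    AnalyticAt ℝ (fun k => seriesSum f (k ^ 2)) k :=
  (hf.analyticAt (abs_sq_lt_one hk)).comp (f := fun k : ℝ => k ^ 2) (analyticAt_id.pow 2)

/-- A combination of `K` and `J` with polynomial coefficients of degree at most `D` vanishing to
total order greater than `2 D + 2` on the unit interval is trivial. -/
lemma eq_zero_of_order_kSeries_jSeries {A B : Polynomial ℝ} {D : ℕ} (hA : A.natDegree ≤ D)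
    (hB : B.natDegree ≤ D) {T : Finset ℝ} (hT : ∀ x ∈ T, |x| < 1) {m : ℝ → ℕ} {f : ℝ → ℝ}
    (hf : ∀ x, |x| < 1 → f x = A.eval x * seriesSum kSeries (x ^ 2) +
      x ^ 2 * B.eval x * seriesSum jSeries (x ^ 2))
    (hm : ∀ x ∈ T, (m x : ℕ∞) ≤ analyticOrderAt f x) (hN : 2 * D + 2 < ∑ x ∈ T, m x) :
    A = 0 ∧ B = 0 := by
  have h := stieltjesChain_hypChain.eq_zero_of_order (A := A) (B := Polynomial.C (1 / 2) * B)
    hA ((Polynomial.natDegree_C_mul_le _ _).trans hB) hT (m := m) (fun x hx => ?_) hN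
  · refine ⟨h.1, ?_⟩
    simpa using h.2
  · refine (hm x hx).trans_eq (analyticOrderAt_congr ?_)
    have hopen : ∀ᶠ y in 𝓝 x, |y| < 1 := continuous_abs.continuousAt.eventually_lt_const (hT x hx)
    filter_upwards [hopen] with y hy
    have h0 := conv_kSeries.expand
    have h1 := ((ConvergesOnDisc.C 2).mul conv_jSeries).expand
    have hB := ((ConvergesOnDisc.X).pow 2).mul (ConvergesOnDisc.coe (Polynomial.C (1 / 2) * B))
    simp only [hypChain_zero, hypChain_one]
    rw [((ConvergesOnDisc.coe A).mul h0).seriesSum_add (hB.mul h1) hy,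
      (ConvergesOnDisc.coe A).seriesSum_mul h0 hy, hB.seriesSum_mul h1 hy,
      ((ConvergesOnDisc.X).pow 2).seriesSum_mul (ConvergesOnDisc.coe _) hy, sq X,
      ConvergesOnDisc.X.seriesSum_mul .X hy, seriesSum_coe, seriesSum_coe, seriesSum_X,
      seriesSum_expand, seriesSum_expand,
      (ConvergesOnDisc.C 2).seriesSum_mul conv_jSeries (abs_sq_lt_one hy), seriesSum_C,
      hf y hy, Polynomial.eval_mul, Polynomial.eval_C]
    ring

/-- The coefficient of `K` in the Wronskian of `r` and the normalised combination. -/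
noncomputable def kCoeff (p q r : Polynomial ℝ) : Polynomial ℝ :=
  r * (-(Polynomial.X ^ 2 * (3 + Polynomial.X ^ 2) * (p + q)) +
      (1 - Polynomial.X ^ 4) * (Polynomial.X * (p + q).derivative) +
      Polynomial.X ^ 2 * (1 + Polynomial.X ^ 2) * p) -
    Polynomial.X * r.derivative * ((1 - Polynomial.X ^ 4) * (p + q))

/-- The coefficient of `J` in the Wronskian of `r` and the normalised combination. -/
noncomputable def jCoeff (p q r : Polynomial ℝ) : Polynomial ℝ :=
  r * (Polynomial.X ^ 2 * (3 + Polynomial.X ^ 2) * q -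
      (1 - Polynomial.X ^ 4) * (Polynomial.X * q.derivative) -
      (1 + Polynomial.X ^ 2) * p - (1 - Polynomial.X ^ 4) * q - r * (1 + Polynomial.X ^ 2)) +
    Polynomial.X * r.derivative * ((1 - Polynomial.X ^ 4) * q)

lemma natDegree_X_mul_derivative_le (p : Polynomial ℝ) :
    (Polynomial.X * p.derivative).natDegree ≤ p.natDegree := by
  rcases Nat.eq_zero_or_pos p.natDegree with h | h
  · rw [Polynomial.derivative_of_natDegree_zero h]
    simp
  · have h1 := Polynomial.natDegree_mul_le (p := Polynomial.X) (q := p.derivative)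
    have h2 := p.natDegree_derivative_le
    rw [Polynomial.natDegree_X] at h1
    omega

lemma natDegree_mul_le_add {p q : Polynomial ℝ} {a b : ℕ} (hp : p.natDegree ≤ a)
    (hq : q.natDegree ≤ b) : (p * q).natDegree ≤ a + b :=
  Polynomial.natDegree_mul_le.trans (add_le_add hp hq)

lemma natDegree_kCoeff_le {p q r : Polynomial ℝ} {N l : ℕ} (hp : p.natDegree ≤ N)
    (hq : q.natDegree ≤ N) (hr : r.natDegree ≤ l) :
    (kCoeff p q r).natDegree ≤ l + (N + 4) := by
  have hpq : (p + q).natDegree ≤ N := Polynomial.natDegree_add_le_of_degree_le hp hq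
  have hd := (natDegree_X_mul_derivative_le (p + q)).trans hpq
  have hd' := (natDegree_X_mul_derivative_le r).trans hr
  have h1 : (Polynomial.X ^ 2 * (3 + Polynomial.X ^ 2) : Polynomial ℝ).natDegree ≤ 4 := by
    compute_degree
  have h2 : (1 - Polynomial.X ^ 4 : Polynomial ℝ).natDegree ≤ 4 := by compute_degree
  have h3 : (Polynomial.X ^ 2 * (1 + Polynomial.X ^ 2) : Polynomial ℝ).natDegree ≤ 4 := by
    compute_degree
  rw [add_comm N]
  refine Polynomial.natDegree_sub_le_of_le (natDegree_mul_le_add hr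
    (Polynomial.natDegree_add_le_of_degree_le (Polynomial.natDegree_add_le_of_degree_le ?_
      (natDegree_mul_le_add h2 hd)) (natDegree_mul_le_add h3 hp)))
    (natDegree_mul_le_add hd' (natDegree_mul_le_add h2 hpq)) |>.trans_eq (max_self _)
  rw [Polynomial.natDegree_neg]
  exact natDegree_mul_le_add h1 hpq

lemma natDegree_jCoeff_le {p q r : Polynomial ℝ} {N l : ℕ} (hp : p.natDegree ≤ N)
    (hq : q.natDegree ≤ N) (hr : r.natDegree ≤ l) :
    (jCoeff p q r).natDegree ≤ l + max (N + 4) (l + 2) := by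
  have hd := (natDegree_X_mul_derivative_le q).trans hq
  have hd' := (natDegree_X_mul_derivative_le r).trans hr
  have h1 : (Polynomial.X ^ 2 * (3 + Polynomial.X ^ 2) : Polynomial ℝ).natDegree ≤ 4 := by
    compute_degree
  have h2 : (1 - Polynomial.X ^ 4 : Polynomial ℝ).natDegree ≤ 4 := by compute_degree
  have h3 : (1 + Polynomial.X ^ 2 : Polynomial ℝ).natDegree ≤ 2 := by compute_degree
  have e1 := natDegree_mul_le_add h1 hq
  have e2 := natDegree_mul_le_add h2 hd
  have e3 := natDegree_mul_le_add h3 hp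
  have e4 := natDegree_mul_le_add h2 hq
  have e5 := natDegree_mul_le_add hr h3
  have e6 : (Polynomial.X ^ 2 * (3 + Polynomial.X ^ 2) * q -
      (1 - Polynomial.X ^ 4) * (Polynomial.X * q.derivative) -
      (1 + Polynomial.X ^ 2) * p - (1 - Polynomial.X ^ 4) * q -
        r * (1 + Polynomial.X ^ 2)).natDegree ≤ max (N + 4) (l + 2) := by
    refine (Polynomial.natDegree_sub_le_of_le (Polynomial.natDegree_sub_le_of_le
      (Polynomial.natDegree_sub_le_of_le (Polynomial.natDegree_sub_le_of_le e1 e2) e3) e4)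
      e5).trans ?_
    omega
  refine Polynomial.natDegree_add_le_of_degree_le (natDegree_mul_le_add hr e6) ?_
  exact (natDegree_mul_le_add hd' e4).trans (by omega)

lemma seriesSum_derivative_kSeries {s : ℝ} (hs : |s| < 1) :
    2 * ((1 - s) * seriesSum (d⁄dX ℝ kSeries) s) = seriesSum kSeries s - seriesSum jSeries s := by
  have hX := ConvergesOnDisc.one.sub .X
  have hd := conv_kSeries.derivative
  have h := congrArg (fun f => seriesSum f s) derivative_kSeries
  rwa [(ConvergesOnDisc.C 2).seriesSum_mul (hX.mul hd) hs, hX.seriesSum_mul hd hs,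
    ConvergesOnDisc.one.seriesSum_sub .X hs, conv_kSeries.seriesSum_sub conv_jSeries hs,
    seriesSum_C, seriesSum_one, seriesSum_X] at h

/-- The combination `p K + q E + r Π` normalised so that its third-kind part is `r` times a
function whose derivative is a multiple of `J`. -/
noncomputable def normalizedSum (p q r : Polynomial ℝ) (φ : ℝ⟦X⟧) (k : ℝ) : ℝ :=
  (1 - k ^ 2) * seriesSum (invSqrt (-1)) (k ^ 2) * (π / 2 *
      (p.eval k * seriesSum kSeries (k ^ 2) + q.eval k * seriesSum eSeries (k ^ 2))) +
    r.eval k * seriesSum φ (k ^ 2)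

lemma analyticAt_normalizedSum (p q r : Polynomial ℝ) {φ : ℝ⟦X⟧} (hφ : ConvergesOnDisc φ)
    {k : ℝ} (hk : |k| < 1) : AnalyticAt ℝ (normalizedSum p q r φ) k := by
  have h1 : AnalyticAt ℝ (fun k : ℝ => 1 - k ^ 2) k := by fun_prop
  exact ((h1.mul (analyticAt_seriesSum_sq conv_invSqrt_neg_one hk)).mul (analyticAt_const.mul
    (((p.analyticAt_eval k).mul (analyticAt_seriesSum_sq conv_kSeries hk)).add
      ((q.analyticAt_eval k).mul (analyticAt_seriesSum_sq conv_eSeries hk))))).add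
    ((r.analyticAt_eval k).mul (analyticAt_seriesSum_sq hφ hk))

/-- The third-kind integral drops out of the Wronskian. -/
lemma polyWronskian_normalizedSum (p q r : Polynomial ℝ) {φ : ℝ⟦X⟧} (hφ : ConvergesOnDisc φ)
    (hφ' : d⁄dX ℝ φ = C (-(π / 4)) * (invSqrt (-1) * jSeries)) {k : ℝ} (hk : |k| < 1) :
    k * (1 + k ^ 2) * polyWronskian r (normalizedSum p q r φ) k =
      π / 2 * seriesSum (invSqrt (-1)) (k ^ 2) *
        ((kCoeff p q r).eval k * seriesSum kSeries (k ^ 2) +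
          k ^ 2 * (jCoeff p q r).eval k * seriesSum jSeries (k ^ 2)) := by
  have hs := abs_sq_lt_one hk
  have d0 : HasDerivAt (fun k : ℝ => 1 - k ^ 2) (-(2 * k)) k := by
    simpa using ((hasDerivAt_id' k).fun_pow 2).const_sub 1
  have d1 := d0.fun_mul (hasDerivAt_seriesSum_sq conv_invSqrt_neg_one hk)
  have d2 := ((p.hasDerivAt k).fun_mul (hasDerivAt_seriesSum_sq conv_kSeries hk)).fun_add
    ((q.hasDerivAt k).fun_mul (hasDerivAt_seriesSum_sq conv_eSeries hk))
  have d3 := (d1.fun_mul (d2.const_mul (π / 2))).fun_add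
    ((r.hasDerivAt k).fun_mul (hasDerivAt_seriesSum_sq hφ hk))
  have hd : deriv (normalizedSum p q r φ) k = _ := d3.deriv
  have hy := seriesSum_derivative_invSqrt_neg_one hs
  have hK := seriesSum_derivative_kSeries hs
  have hyj := conv_invSqrt_neg_one.mul conv_jSeries
  rw [polyWronskian, hd, normalizedSum, derivative_eSeries, hφ',
    (ConvergesOnDisc.C _).seriesSum_mul conv_jSeries hs,
    (ConvergesOnDisc.C _).seriesSum_mul hyj hs,
    conv_invSqrt_neg_one.seriesSum_mul conv_jSeries hs, seriesSum_C, seriesSum_C,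
    seriesSum_eSeries hs, kCoeff, jCoeff]
  simp only [Polynomial.eval_add, Polynomial.eval_sub, Polynomial.eval_mul, Polynomial.eval_neg,
    Polynomial.eval_pow, Polynomial.eval_X, Polynomial.eval_one, Polynomial.eval_ofNat,
    Polynomial.derivative_add]
  generalize seriesSum (d⁄dX ℝ (invSqrt (-1))) (k ^ 2) = y' at *
  generalize seriesSum (invSqrt (-1)) (k ^ 2) = y at *
  generalize seriesSum (d⁄dX ℝ kSeries) (k ^ 2) = κ' at *
  generalize seriesSum kSeries (k ^ 2) = κ at *
  generalize seriesSum jSeries (k ^ 2) = j at *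
  linear_combination (k * r.eval k * (1 - k ^ 2) * (2 * k) * (π / 2 *
      (p.eval k * κ + q.eval k * (κ - k ^ 2 * j)))) * hy +
    (k * (1 + k ^ 2) * r.eval k * y * (π / 2) * p.eval k * k) * hK

end ZeroCount

section Bound

lemma analyticAt_invSqrt_factor {k : ℝ} (hk : |k| < 1) :
    AnalyticAt ℝ (fun k => (1 + k ^ 2) * seriesSum (invSqrt (-1)) (k ^ 2)) k :=
  (by fun_prop : AnalyticAt ℝ (fun k : ℝ => 1 + k ^ 2) k).mul
    (analyticAt_seriesSum_sq conv_invSqrt_neg_one hk)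

lemma seriesSum_invSqrt_neg_one_ne_zero {s : ℝ} (hs : |s| < 1) :
    seriesSum (invSqrt (-1)) s ≠ 0 := fun h => by
  simpa [h] using seriesSum_invSqrt_neg_one_sq hs

lemma sum_order_normalizedSum_le_of_eq_zero {p q : Polynomial ℝ} {φ : ℝ⟦X⟧} {N : ℕ}
    (hp : p.natDegree ≤ N) (hq : q.natDegree ≤ N)
    (hne : ∃ k, |k| < 1 ∧ normalizedSum p q 0 φ k ≠ 0) {T : Finset ℝ} (hT : ∀ x ∈ T, |x| < 1)
    (hφ : ConvergesOnDisc φ)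
    {m : ℝ → ℕ} (hm : ∀ x ∈ T, (m x : ℕ∞) ≤ analyticOrderAt (normalizedSum p q 0 φ) x) :
    ∑ x ∈ T, m x ≤ 2 * N + 2 := by
  by_contra! hlt
  have hinv : ∀ x : ℝ, |x| < 1 → AnalyticAt ℝ
      (fun k => ((1 - k ^ 2) * seriesSum (invSqrt (-1)) (k ^ 2) * (π / 2))⁻¹) x := fun x hx => by
    refine AnalyticAt.fun_inv (((by fun_prop : AnalyticAt ℝ (fun k : ℝ => 1 - k ^ 2) x).mul
      (analyticAt_seriesSum_sq conv_invSqrt_neg_one hx)).mul analyticAt_const) ?_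
    have h1 : 1 - x ^ 2 ≠ 0 := by linarith [(abs_lt.1 (abs_sq_lt_one hx)).2]
    have h2 := seriesSum_invSqrt_neg_one_ne_zero (abs_sq_lt_one hx)
    positivity
  have h := eq_zero_of_order_kSeries_jSeries (A := p + q) (B := -q) (D := N)
    (Polynomial.natDegree_add_le_of_degree_le hp hq) (by rwa [Polynomial.natDegree_neg]) hT
    (m := m) (f := fun k => ((1 - k ^ 2) * seriesSum (invSqrt (-1)) (k ^ 2) * (π / 2))⁻¹ *
      normalizedSum p q 0 φ k) (fun x hx => ?_)
    (fun x hx => (hm x hx).trans (le_analyticOrderAt_mul_left (hinv x (hT x hx))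
      (analyticAt_normalizedSum p q 0 hφ (hT x hx)))) hlt
  · obtain ⟨k, hk, hk0⟩ := hne
    have hq0 : q = 0 := neg_eq_zero.1 h.2
    have hp0 : p = 0 := by simpa [hq0] using h.1
    exact hk0 (by simp [normalizedSum, hp0, hq0])
  · have hs := abs_sq_lt_one hx
    have h1 : 1 - x ^ 2 ≠ 0 := by linarith [(abs_lt.1 hs).2]
    have h2 := seriesSum_invSqrt_neg_one_ne_zero hs
    have h3 := Real.pi_ne_zero
    simp only [normalizedSum, seriesSum_eSeries hs, Polynomial.eval_add, Polynomial.eval_neg,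
      Polynomial.eval_zero]
    field_simp
    ring

lemma sum_order_normalizedSum_le {p q r : Polynomial ℝ} {φ : ℝ⟦X⟧} {N l : ℕ} (hr0 : r ≠ 0)
    (hp : p.natDegree ≤ N) (hq : q.natDegree ≤ N) (hr : r.natDegree ≤ l)
    (hφ : ConvergesOnDisc φ) (hφ' : d⁄dX ℝ φ = C (-(π / 4)) * (invSqrt (-1) * jSeries))
    (hne : ∃ k, |k| < 1 ∧ normalizedSum p q r φ k ≠ 0) {T : Finset ℝ} (hT : ∀ x ∈ T, |x| < 1)
    {m : ℝ → ℕ} (hm1 : ∀ x ∈ T, 1 ≤ m x)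
    (hm : ∀ x ∈ T, (m x : ℕ∞) ≤ analyticOrderAt (normalizedSum p q r φ) x) :
    ∑ x ∈ T, m x ≤ 2 * (l + max (N + 4) (l + 2)) + 2 + (l + 1) := by
  have hf := fun x hx => analyticAt_normalizedSum p q r hφ (k := x) hx
  obtain ⟨T', m', hT', hm', hsum⟩ := exists_order_polyWronskian hr0 hf hT hm1 hm
  by_contra! hlt
  have hfac : ∀ x : ℝ, |x| < 1 → AnalyticAt ℝ (fun k => 2 / π * ((1 + k ^ 2) *
      seriesSum (invSqrt (-1)) (k ^ 2)) * (k * (1 + k ^ 2))) x := fun x hx =>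
    (analyticAt_const.mul (analyticAt_invSqrt_factor hx)).mul (by fun_prop)
  obtain ⟨hA, hB⟩ := eq_zero_of_order_kSeries_jSeries (A := kCoeff p q r) (B := jCoeff p q r)
    (D := l + max (N + 4) (l + 2))
    ((natDegree_kCoeff_le hp hq hr).trans (by omega)) (natDegree_jCoeff_le hp hq hr) hT' (m := m')
    (f := fun k => (2 / π * ((1 + k ^ 2) * seriesSum (invSqrt (-1)) (k ^ 2)) *
      (k * (1 + k ^ 2))) * polyWronskian r (normalizedSum p q r φ) k)
    (fun x hx => by
      have h1 := polyWronskian_normalizedSum p q r hφ hφ' hx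
      have h2 := seriesSum_invSqrt_neg_one_sq (abs_sq_lt_one hx)
      rw [mul_assoc, h1]
      have h3 := Real.pi_ne_zero
      field_simp
      linear_combination ((kCoeff p q r).eval x * seriesSum kSeries (x ^ 2) +
        x ^ 2 * (jCoeff p q r).eval x * seriesSum jSeries (x ^ 2)) * h2)
    (fun x hx => (hm' x hx).trans (le_analyticOrderAt_mul_left (hfac x (hT' x hx))
      (analyticAt_polyWronskian (hf x (hT' x hx))))) (by omega)
  have hW : ∀ x, |x| < 1 → x ≠ 0 → polyWronskian r (normalizedSum p q r φ) x = 0 :=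
    fun x hx hx0 => by
      have h1 := polyWronskian_normalizedSum p q r hφ hφ' hx
      simp only [hA, hB, Polynomial.eval_zero, zero_mul, mul_zero, add_zero] at h1
      exact (mul_eq_zero.1 h1).resolve_left (mul_ne_zero hx0 (by positivity))
  have hW0 : polyWronskian r (normalizedSum p q r φ) 0 = 0 := by
    have hc := (analyticAt_polyWronskian (r := r) (hf 0 (by simp))).continuousAt
    refine tendsto_nhds_unique (hc.tendsto.mono_left (nhdsWithin_le_nhds (s := {0}ᶜ)))
      (tendsto_const_nhds.congr' ?_)
    have hopen : ∀ᶠ y in 𝓝[≠] (0 : ℝ), |y| < 1 :=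
      nhdsWithin_le_nhds (continuous_abs.continuousAt.eventually_lt_const (by simp))
    filter_upwards [hopen, self_mem_nhdsWithin] with y hy hy0
    exact (hW y hy hy0).symm
  obtain ⟨c, hc⟩ := exists_eq_mul_of_polyWronskian_eq_zero hr0 hf fun x hx => by
    by_cases hx0 : x = 0
    · rw [hx0, hW0]
    · exact hW x hx hx0
  have hc0 : c ≠ 0 := by
    rintro rfl
    obtain ⟨k, hk, hk0⟩ := hne
    exact hk0 (by rw [hc k hk, zero_mul])
  refine hr0 (eq_zero_of_order_kSeries_jSeries (A := r) (B := 0) hr (by simp) hT (m := m)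
    (f := fun k => (c⁻¹ * seriesSum kSeries (k ^ 2)) * normalizedSum p q r φ k)
    (fun x hx => ?_) (fun x hx => (hm x hx).trans (le_analyticOrderAt_mul_left
      (analyticAt_const.mul (analyticAt_seriesSum_sq conv_kSeries (hT x hx)))
      (hf x (hT x hx)))) (by omega)).1
  rw [hc x hx, Polynomial.eval_zero]
  field_simp
  ring

lemma natCast_zeroMult_le {f : ℝ → ℝ} {x : ℝ} (hf : AnalyticAt ℝ f x) :
    (zeroMult f x : ℕ∞) ≤ analyticOrderAt f x :=
  (natCast_le_analyticOrderAt_iff_iteratedDeriv_eq_zero hf).2 fun i hi => by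
    simpa using Nat.notMem_of_lt_sInf hi

end Bound

/-- Theorem 1.4 of the paper: bound for the number of zeros in `(-1,1)`,
counted with multiplicity, of `I(k) = p(k)K(k) + q(k)E(k) + r(k)Π(2k²/(1+k²),k)`. -/
theorem zeros_of_pK_qE_rPi_rational_mu
    (m n l : ℕ) (p q r : Polynomial ℝ)
    (hp : p.natDegree ≤ m) (hq : q.natDegree ≤ n) (hr : r.natDegree ≤ l)
    (hI : ¬ ∀ k ∈ Set.Ioo (-1 : ℝ) 1,
      p.eval k * Kc k + q.eval k * Ec k
        + r.eval k * Pic (2 * k ^ 2 / (1 + k ^ 2)) k = 0) :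
    ∀ T : Finset ℝ,
      (∀ x ∈ T, x ∈ Set.Ioo (-1 : ℝ) 1 ∧
        p.eval x * Kc x + q.eval x * Ec x
          + r.eval x * Pic (2 * x ^ 2 / (1 + x ^ 2)) x = 0) →
      ∑ x ∈ T,
        zeroMult (fun k => p.eval k * Kc k + q.eval k * Ec k
          + r.eval k * Pic (2 * k ^ 2 / (1 + k ^ 2)) k) x
        ≤ if l ≤ max m n + 2 then 2 * max m n + 3 * l + 11 else 5 * l + 7 := by
  intro T hT
  obtain ⟨φ, hφ, hφ', hφeq⟩ := exists_piSeries
  set I : ℝ → ℝ := fun k => p.eval k * Kc k + q.eval k * Ec k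
    + r.eval k * Pic (2 * k ^ 2 / (1 + k ^ 2)) k with hIdef
  set w : ℝ → ℝ := fun k => (1 - k ^ 2) * seriesSum (invSqrt (-1)) (k ^ 2) with hw
  have hwI : ∀ k, |k| < 1 → w k * I k = normalizedSum p q r φ k := fun k hk => by
    have hs := abs_sq_lt_one hk
    have h := hφeq (k ^ 2) hs
    simp only [hIdef, hw, normalizedSum]
    rw [Kc_eq hk, Ec_eq hk, Pic_eq, seriesSum_eSeries hs, ← h]
    simp only [piIntegrand]
    ring
  have hw0 : ∀ k, |k| < 1 → w k ≠ 0 := fun k hk => by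
    have hs := abs_sq_lt_one hk
    exact mul_ne_zero (by linarith [(abs_lt.1 hs).2]) (seriesSum_invSqrt_neg_one_ne_zero hs)
  have hwan : ∀ k, |k| < 1 → AnalyticAt ℝ w k := fun k hk =>
    (by fun_prop : AnalyticAt ℝ (fun k : ℝ => 1 - k ^ 2) k).mul
      (analyticAt_seriesSum_sq conv_invSqrt_neg_one hk)
  have hev : ∀ x : ℝ, |x| < 1 → ∀ᶠ y in 𝓝 x, |y| < 1 := fun x hx =>
    continuous_abs.continuousAt.eventually_lt_const hx
  have hIan : ∀ k, |k| < 1 → AnalyticAt ℝ I k := fun k hk => by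
    refine ((analyticAt_normalizedSum p q r hφ hk).div (hwan k hk) (hw0 k hk)).congr ?_
    filter_upwards [hev k hk] with y hy
    rw [Pi.div_apply, ← hwI y hy, mul_div_cancel_left₀ _ (hw0 y hy)]
  have hne : ∃ k, |k| < 1 ∧ normalizedSum p q r φ k ≠ 0 := by
    push Not at hI
    obtain ⟨k, hk, hk0⟩ := hI
    exact ⟨k, abs_lt.2 hk, by
      rw [← hwI k (abs_lt.2 hk)]
      exact mul_ne_zero (hw0 k (abs_lt.2 hk)) hk0⟩
  have hT1 : ∀ x ∈ T, |x| < 1 := fun x hx => abs_lt.2 (hT x hx).1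
  have hord : ∀ x ∈ T, (zeroMult I x : ℕ∞) ≤ analyticOrderAt (normalizedSum p q r φ) x :=
    fun x hx => by
      have hx1 := hT1 x hx
      refine ((natCast_zeroMult_le (hIan x hx1)).trans
        (le_analyticOrderAt_mul_left (hwan x hx1) (hIan x hx1))).trans_eq (analyticOrderAt_congr ?_)
      filter_upwards [hev x hx1] with y hy using hwI y hy
  have hp' := hp.trans (le_max_left m n)
  have hq' := hq.trans (le_max_right m n)
  by_cases hr0 : r = 0
  · subst hr0
    have := sum_order_normalizedSum_le_of_eq_zero hp' hq' hne hT1 hφ hord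
    split_ifs <;> omega
  · rw [← Finset.sum_filter_ne_zero]
    have := sum_order_normalizedSum_le hr0 hp' hq' hr hφ hφ' hne
      (T := T.filter fun x => zeroMult I x ≠ 0)
      (fun x hx => hT1 x (Finset.mem_filter.1 hx).1)
      (fun x hx => Nat.one_le_iff_ne_zero.2 (Finset.mem_filter.1 hx).2)
      (fun x hx => hord x (Finset.mem_filter.1 hx).1)
    split_ifs <;> omega
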